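/- Let X be a normal complex variety and let p: X → Y be a finite dominant morphism to a smooth complex variety Y. Suppose D ⊂ Y is a simple normal crossing divisor and p is smooth over Y \ D. Then X has finite quotient singularities. -/

import Mathlib

/-!
Statement 1 (Kollár): Let `X` be a normal complex variety and `p : X ⟶ Y` a finite dominant
morphism to a smooth complex variety `Y`.  Suppose `D ⊆ Y` is a simple normal crossing divisor
and `p` is smooth over `Y \ D`.  Then `X` has finite quotient singularities.
-/

open AlgebraicGeometry CategoryTheory

/-- `Spec ℂ`, the base of our complex varieties. -/
noncomputable abbrev SpecC : Scheme := Spec (CommRingCat.of ℂ)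

/-- Affine `n`-space over `ℂ`. -/
noncomputable abbrev AffineSpaceC (n : ℕ) : Scheme :=
  Spec (CommRingCat.of (MvPolynomial (Fin n) ℂ))

/-- The union of the coordinate hyperplanes `{xᵢ = 0}`, `i ∈ s`, in affine `n`-space:
the zero locus of the monomial `∏ i ∈ s, xᵢ`. -/
noncomputable def coordinateHyperplanes (n : ℕ) (s : Finset (Fin n)) :
    Set (AffineSpaceC n) :=
  (AffineSpaceC n).zeroLocus (U := ⊤)
    {(Scheme.ΓSpecIso (CommRingCat.of (MvPolynomial (Fin n) ℂ))).inv
      (∏ i ∈ s, MvPolynomial.X i)}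

/-- A closed subset `D ⊆ Y` is a (simple) normal crossing divisor if, locally on `Y`, there is
an étale morphism `g` to affine `n`-space under which `D` is the preimage of a union of
coordinate hyperplanes.  (This is the local-chart characterization of a normal crossing
divisor on a smooth variety.) -/
def IsSNCDivisor {Y : Scheme} (D : Set Y) : Prop :=
  IsClosed D ∧
    ∀ y : Y, ∃ (U : Y.Opens) (_ : y ∈ U) (n : ℕ) (s : Finset (Fin n))
      (g : U.toScheme ⟶ AffineSpaceC n), IsEtale g ∧
        ∀ u : U.toScheme, g.base u ∈ coordinateHyperplanes n s ↔ (U.ι.base u : Y) ∈ D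

/-- The fixed subalgebra `R^G` of a `ℂ`-algebra `R` under an action of a group `G` by
`ℂ`-algebra automorphisms. -/
def fixedSubalgebra (G : Type) [Group G] (R : Type) [CommRing R] [Algebra ℂ R]
    [MulSemiringAction G R] [SMulCommClass G ℂ R] : Subalgebra ℂ R where
  carrier := {r | ∀ g : G, g • r = r}
  mul_mem' {a b} ha hb g := by rw [smul_mul', ha g, hb g]
  add_mem' {a b} ha hb g := by rw [smul_add, ha g, hb g]
  algebraMap_mem' c g := by
    rw [Algebra.algebraMap_eq_smul_one, smul_comm, smul_one]

/-- A chart witnessing that, étale-locally at `x`, the scheme `X` is the quotient of a smooth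
complex variety (here `Spec R`, `R` a smooth `ℂ`-algebra) by a finite group `G`:
an étale morphism `Spec (R^G) ⟶ X` whose image contains `x`. -/
structure FiniteQuotientChart (X : Scheme) (x : X) where
  /-- the coordinate ring of the smooth local model -/
  R : Type
  [commRing : CommRing R]
  [alg : Algebra ℂ R]
  /-- the local model is a smooth affine complex variety -/
  smooth : Algebra.Smooth ℂ R
  /-- the finite group -/
  G : Type
  [group : Group G]
  [finite : Finite G]
  [action : MulSemiringAction G R]
  [smulComm : SMulCommClass G ℂ R]
  /-- the étale chart from the quotient `Spec (R^G)` to `X` -/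
  f : Spec (CommRingCat.of (fixedSubalgebra G R)) ⟶ X
  etale : IsEtale f
  mem : x ∈ Set.range f.base

/-- A scheme has (at worst) finite quotient singularities if, étale-locally around every point,
it is the quotient of a smooth complex variety by a finite group. -/
def HasFiniteQuotientSingularities (X : Scheme) : Prop :=
  ∀ x : X, Nonempty (FiniteQuotientChart X x)

/-- A scheme is normal if all of its local rings are integrally closed domains. -/
def IsNormalScheme (X : Scheme) : Prop :=
  ∀ x : X, IsIntegrallyClosed (X.presheaf.stalk x)

theorem aux_ideal_eq_top_of_pderiv {n : ℕ} (I : Ideal (MvPolynomial (Fin n) ℂ))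
    (hI : ∀ i, ∀ q ∈ I, MvPolynomial.pderiv i q ∈ I) (h0 : I ≠ ⊥) : I = ⊤ := by
  obtain ⟨q, hq, hq0⟩ := Submodule.exists_mem_ne_zero_of_ne_bot h0
  induction hN : q.totalDegree using Nat.strong_induction_on generalizing q with
  | _ N ih =>
  rcases Nat.eq_zero_or_pos N with h | h
  · rw [h, MvPolynomial.totalDegree_eq_zero_iff_eq_C] at hN
    rw [hN] at hq hq0
    refine Ideal.eq_top_of_isUnit_mem _ hq ?_
    exact IsUnit.map MvPolynomial.C (isUnit_iff_ne_zero.mpr (fun h => hq0 (by simp [h])))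
  · have h1 : ∃ m ∈ q.support, ∃ i, m i ≠ 0 := by
      by_contra! hcon
      have : q.totalDegree = 0 := by
        rw [MvPolynomial.totalDegree_eq_zero_iff]
        exact fun m hm i => hcon m hm i
      omega
    obtain ⟨m, hm, i, hmi⟩ := h1
    refine ih (MvPolynomial.pderiv i q).totalDegree ?_ _ (hI i q hq) ?_ rfl
    · rw [← hN, MvPolynomial.totalDegree, Finset.sup_lt_iff (by simpa using hN ▸ h)]
      intro b hb
      rw [MvPolynomial.mem_support_iff, MvPolynomial.coeff_pderiv] at hb
      have hb' : b + Finsupp.single i 1 ∈ q.support :=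
        MvPolynomial.mem_support_iff.mpr (left_ne_zero_of_mul hb)
      have := MvPolynomial.le_totalDegree hb'
      rw [Finsupp.sum_add_index' (by simp) (by simp)] at this
      simp at this
      omega
    · intro h
      have := congrArg (MvPolynomial.coeff (m - Finsupp.single i 1)) h
      rw [MvPolynomial.coeff_pderiv, Finsupp.sub_add_single_one_cancel hmi] at this
      simp only [MvPolynomial.coeff_zero, mul_eq_zero] at this
      rcases this with h | h
      · exact (MvPolynomial.mem_support_iff.mp hm) h
      · exact Nat.cast_add_one_ne_zero _ h

theorem aux_deriv_algebraMap {n : ℕ} {R : Type} [CommRing R] [Algebra ℂ R]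
    [Algebra (MvPolynomial (Fin n) ℂ) R] [IsScalarTower ℂ (MvPolynomial (Fin n) ℂ) R]
    (D : Fin n → Derivation ℂ R R)
    (hD : ∀ i j, D i (algebraMap _ R (MvPolynomial.X j : MvPolynomial (Fin n) ℂ)) =
      if i = j then 1 else 0) (i : Fin n) (q : MvPolynomial (Fin n) ℂ) :
    D i (algebraMap _ R q) = algebraMap _ R (MvPolynomial.pderiv i q) := by
  classical
  have : (D i).compAlgebraMap (MvPolynomial (Fin n) ℂ) =
      (Algebra.linearMap (MvPolynomial (Fin n) ℂ) R).compDer (MvPolynomial.pderiv i) := by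
    apply MvPolynomial.derivation_ext
    intro j
    simp [hD, Pi.single_apply, eq_comm]
  simpa using congrArg (fun d => d q) this

theorem aux_ideal_eq_top_of_deriv {n : ℕ} {R : Type} [CommRing R] [IsDomain R] [Algebra ℂ R]
    [Algebra (MvPolynomial (Fin n) ℂ) R] [IsScalarTower ℂ (MvPolynomial (Fin n) ℂ) R]
    [Algebra.IsAlgebraic (MvPolynomial (Fin n) ℂ) R]
    (D : Fin n → Derivation ℂ R R)
    (hD : ∀ i j, D i (algebraMap _ R (MvPolynomial.X j : MvPolynomial (Fin n) ℂ)) =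
      if i = j then 1 else 0) (J : Ideal R) (hJ : ∀ i, ∀ a ∈ J, D i a ∈ J) (h0 : J ≠ ⊥) :
    J = ⊤ := by
  have key := aux_deriv_algebraMap D hD
  have : J.comap (algebraMap (MvPolynomial (Fin n) ℂ) R) = ⊤ := by
    apply aux_ideal_eq_top_of_pderiv
    · intro i q hq
      rw [Ideal.mem_comap, ← key]
      exact hJ i _ hq
    · obtain ⟨a, ha, ha0⟩ := Submodule.exists_mem_ne_zero_of_ne_bot h0
      exact Ideal.comap_ne_bot_of_algebraic_mem ha0 ha (Algebra.IsAlgebraic.isAlgebraic a)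
  rw [Ideal.eq_top_iff_one, Ideal.mem_comap, map_one] at this
  exact (Ideal.eq_top_iff_one _).mpr this

theorem aux_algebraMap_injective {n : ℕ} {R : Type} [CommRing R] [IsDomain R] [Algebra ℂ R]
    [Algebra (MvPolynomial (Fin n) ℂ) R] [IsScalarTower ℂ (MvPolynomial (Fin n) ℂ) R]
    (D : Fin n → Derivation ℂ R R)
    (hD : ∀ i j, D i (algebraMap _ R (MvPolynomial.X j : MvPolynomial (Fin n) ℂ)) =
      if i = j then 1 else 0) : Function.Injective (algebraMap (MvPolynomial (Fin n) ℂ) R) := by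
  rw [RingHom.injective_iff_ker_eq_bot]
  by_contra h0
  have := aux_ideal_eq_top_of_pderiv (RingHom.ker (algebraMap (MvPolynomial (Fin n) ℂ) R)) (by
    intro i q hq
    rw [RingHom.mem_ker, ← aux_deriv_algebraMap D hD, RingHom.mem_ker.mp hq, map_zero]) h0
  exact RingHom.ker_ne_top _ this

/-- twisted module -/
def AuxTwist {R : Type} [CommRing R] (M : Type) [AddCommGroup M] [Module R M]
    {A : Type} [CommRing A] [Algebra A R]  (_ : Derivation A R R) : Type := M × M

instance {R : Type} [CommRing R] (M : Type) [AddCommGroup M] [Module R M]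
    {A : Type} [CommRing A] [Algebra A R]  (d : Derivation A R R) : AddCommGroup (AuxTwist M d) :=
  inferInstanceAs (AddCommGroup (M × M))

instance {R : Type} [CommRing R] (M : Type) [AddCommGroup M] [Module R M]
    {A : Type} [CommRing A] [Algebra A R]  (d : Derivation A R R) : Module R (AuxTwist M d) where
  smul b x := ((b • x.1, b • x.2 + d b • x.1) : M × M)
  one_smul x := by
    change ((1 : R) • x.1, (1 : R) • x.2 + d 1 • x.1) = x
    simp
    rfl
  mul_smul a b x := by
    change ((a * b) • x.1, (a * b) • x.2 + d (a * b) • x.1) =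
      (a • b • x.1, a • (b • x.2 + d b • x.1) + d a • b • x.1)
    ext
    · simp [mul_smul]
    · simp only [Derivation.leibniz, smul_eq_mul, add_smul, mul_smul, smul_add]
      rw [smul_comm b (d a)]; abel
  smul_zero a := by
    change (a • (0 : M), a • (0 : M) + d a • (0 : M)) = 0
    simp
  smul_add a x y := by
    change (a • (x.1 + y.1), a • (x.2 + y.2) + d a • (x.1 + y.1)) =
      ((a • x.1, a • x.2 + d a • x.1) : M × M) + (a • y.1, a • y.2 + d a • y.1)
    ext
    · simp
    · simp only [smul_add, Prod.mk_add_mk]; abel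
  add_smul a b x := by
    change ((a + b) • x.1, (a + b) • x.2 + d (a + b) • x.1) =
      ((a • x.1, a • x.2 + d a • x.1) : M × M) + (b • x.1, b • x.2 + d b • x.1)
    ext
    · simp [add_smul]
    · simp only [add_smul, map_add, Prod.mk_add_mk]; abel
  zero_smul x := by
    change ((0 : R) • x.1, (0 : R) • x.2 + d 0 • x.1) = 0
    simp

/-- if `a` kills all of Ω, then so does `D a`. -/
theorem aux_kaehler_ann {P R A : Type} [CommRing P] [CommRing R] [Algebra P R]
    [CommRing A] [Algebra A R]
    (d : Derivation A R R) (hd : ∀ p : P, ∃ q : P, d (algebraMap P R p) = algebraMap P R q)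
    (a : R) (ha : ∀ w : Ω[R⁄P], a • w = 0) (w : Ω[R⁄P]) : d a • w = 0 := by
  letI : Module P (AuxTwist (Ω[R⁄P]) d) := Module.compHom _ (algebraMap P R)
  haveI : IsScalarTower P R (AuxTwist (Ω[R⁄P]) d) := IsScalarTower.of_algebraMap_smul (fun _ _ => rfl)
  let E0 : R →+ (AuxTwist (Ω[R⁄P]) d) :=
    { toFun := fun r => ((KaehlerDifferential.D P R r, KaehlerDifferential.D P R (d r)) :
        (Ω[R⁄P]) × (Ω[R⁄P]))
      map_zero' := by simp; rfl
      map_add' := fun x y => by simp; rfl }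
  have hE0 : ∀ x y, E0 (x * y) = x • E0 y + y • E0 x := by
    intro x y
    change ((KaehlerDifferential.D P R (x * y), KaehlerDifferential.D P R (d (x * y))) :
        (Ω[R⁄P]) × (Ω[R⁄P])) = ((x • KaehlerDifferential.D P R y,
          x • KaehlerDifferential.D P R (d y) + d x • KaehlerDifferential.D P R y) :
        (Ω[R⁄P]) × (Ω[R⁄P])) + ((y • KaehlerDifferential.D P R x,
          y • KaehlerDifferential.D P R (d x) + d y • KaehlerDifferential.D P R x) :
        (Ω[R⁄P]) × (Ω[R⁄P]))
    ext
    · simp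
    · simp only [Derivation.leibniz, map_add, smul_eq_mul, Prod.mk_add_mk]; abel
  have hEP : ∀ p : P, E0 (algebraMap P R p) = 0 := by
    intro p
    obtain ⟨q, hq⟩ := hd p
    change ((KaehlerDifferential.D P R (algebraMap P R p),
      KaehlerDifferential.D P R (d (algebraMap P R p))) : (Ω[R⁄P]) × (Ω[R⁄P])) = 0
    rw [hq]; simp
  let E : Derivation P R (AuxTwist (Ω[R⁄P]) d) := Derivation.mk'
    { toFun := E0, map_add' := E0.map_add, map_smul' := fun p x => by
        rw [Algebra.smul_def, hE0, hEP, smul_zero, add_zero, RingHom.id_apply, algebraMap_smul] }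
    hE0
  have h1 : ∀ w : Ω[R⁄P], (E.liftKaehlerDifferential w : (Ω[R⁄P]) × (Ω[R⁄P])).1 = w := by
    intro w
    have hw : w ∈ Submodule.span R (Set.range (KaehlerDifferential.D P R)) := by
      rw [KaehlerDifferential.span_range_derivation]; trivial
    induction hw using Submodule.span_induction with
    | mem x hx =>
      obtain ⟨r, rfl⟩ := hx
      rw [Derivation.liftKaehlerDifferential_comp_D]; rfl
    | zero => rw [map_zero]; rfl
    | add x y _ _ hx hy =>
      rw [map_add]; exact congrArg₂ (· + ·) hx hy
    | smul b x _ hx =>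
      rw [map_smul]; exact congrArg (b • ·) hx
  have h2 := congrArg E.liftKaehlerDifferential (ha w)
  rw [map_smul, map_zero] at h2
  have h3 : a • (E.liftKaehlerDifferential w : (Ω[R⁄P]) × (Ω[R⁄P])).2 +
    d a • (E.liftKaehlerDifferential w : (Ω[R⁄P]) × (Ω[R⁄P])).1 = 0 :=
    congrArg (fun x : (Ω[R⁄P]) × (Ω[R⁄P]) => x.2) h2
  rwa [ha, h1, zero_add] at h3

theorem aux_h1_elem {R : Type} [CommRing R] [Algebra ℂ R] {m : ℕ}
    (P : Algebra.Generators ℂ R (Fin m)) (h : P.toExtension.Ring) (hh : h ∈ P.toExtension.ker) :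
    P.toExtension.cotangentComplex (.mk ⟨h, hh⟩) = 0 ↔
      ∀ i, MvPolynomial.aeval P.val (MvPolynomial.pderiv i h) = 0 := by
  rw [Algebra.Extension.cotangentComplex_mk, ← P.cotangentSpaceBasis.repr.map_eq_zero_iff,
    Finsupp.ext_iff]
  refine forall_congr' fun i => ?_
  rw [P.cotangentSpaceBasis_repr_one_tmul]
  rfl

theorem aux_mk_eq_zero {R : Type} [CommRing R] [Algebra ℂ R] {m : ℕ}
    (P : Algebra.Generators ℂ R (Fin m)) (h : P.toExtension.Ring) (hh : h ∈ P.toExtension.ker) :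
    (Algebra.Extension.Cotangent.mk ⟨h, hh⟩ : P.toExtension.Cotangent) = 0 ↔
      h ∈ P.toExtension.ker ^ 2 := by
  rw [← Ideal.toCotangent_eq_zero P.toExtension.ker ⟨h, hh⟩]
  constructor
  · intro h; exact congrArg (·.val) h
  · intro h; exact Algebra.Extension.Cotangent.ext h

theorem aux_smul_mk {R : Type} [CommRing R] [Algebra ℂ R] {m : ℕ}
    (P : Algebra.Generators ℂ R (Fin m)) (h : P.toExtension.Ring) (hh : h ∈ P.toExtension.ker)
    (q : P.toExtension.Ring)
    (h0 : (MvPolynomial.aeval P.val q) •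
      (Algebra.Extension.Cotangent.mk ⟨h, hh⟩ : P.toExtension.Cotangent) = 0) :
    q * h ∈ P.toExtension.ker ^ 2 := by
  rw [← aux_mk_eq_zero P _ (Ideal.mul_mem_left _ q hh)]
  refine Eq.trans ?_ h0
  exact (Algebra.Extension.Cotangent.mk.map_smul q ⟨h, hh⟩).trans
    ((algebraMap_smul R q _).symm.trans 
      (congrArg (· • _) (Algebra.Generators.algebraMap_apply P q)))

theorem aux_mem_comm {m : ℕ} (I : Ideal (MvPolynomial (Fin m) ℂ))
    (E : Derivation ℂ (MvPolynomial (Fin m) ℂ) (MvPolynomial (Fin m) ℂ))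
    (h : MvPolynomial (Fin m) ℂ) (hh : ∀ i, MvPolynomial.pderiv i h ∈ I) : E h ∈ I := by
  have : E = ∑ i, E (MvPolynomial.X i) • MvPolynomial.pderiv i := by
    apply MvPolynomial.derivation_ext
    intro j
    rw [← Derivation.coeFnAddMonoidHom_apply, ← Derivation.coeFnAddMonoidHom_apply, map_sum]
    simp [Derivation.coe_smul, MvPolynomial.pderiv_X, Pi.single_apply, Finset.sum_apply]
  rw [this, ← Derivation.coeFnAddMonoidHom_apply, map_sum, Finset.sum_apply]
  exact sum_mem fun i _ => by
    simpa using I.mul_mem_left _ (hh i)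

theorem aux_h1 {n : ℕ} {R : Type} [CommRing R] [IsDomain R] [Algebra ℂ R]
    [Algebra.FiniteType ℂ R]
    [Algebra (MvPolynomial (Fin n) ℂ) R] [IsScalarTower ℂ (MvPolynomial (Fin n) ℂ) R]
    [Algebra.IsAlgebraic (MvPolynomial (Fin n) ℂ) R]
    (D : Fin n → Derivation ℂ R R)
    (hD : ∀ i j, D i (algebraMap _ R (MvPolynomial.X j : MvPolynomial (Fin n) ℂ)) =
      if i = j then 1 else 0) : Subsingleton (Algebra.H1Cotangent ℂ R) := by
  obtain ⟨m, π, hπ⟩ := Algebra.FiniteType.iff_quotient_mvPolynomial''.mp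
    (inferInstance : Algebra.FiniteType ℂ R)
  let P := Algebra.Generators.ofAlgHom π hπ
  have hval : MvPolynomial.aeval P.val = π := by
    apply MvPolynomial.algHom_ext; intro i; simp [P]; rfl
  let I : Ideal (MvPolynomial (Fin m) ℂ) := RingHom.ker π
  have hker : P.toExtension.ker = I := Algebra.Generators.ker_ofAlgHom π hπ
  let H : Ideal (MvPolynomial (Fin m) ℂ) :=
    { carrier := {h | h ∈ I ∧ ∀ i, MvPolynomial.pderiv i h ∈ I}
      zero_mem' := ⟨I.zero_mem, fun i => by simp⟩
      add_mem' := fun {a b} ha hb => ⟨I.add_mem ha.1 hb.1, fun i => by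
        rw [map_add]; exact I.add_mem (ha.2 i) (hb.2 i)⟩
      smul_mem' := fun c x hx => ⟨I.mul_mem_left _ hx.1, fun i => by
        rw [smul_eq_mul, Derivation.leibniz]
        exact I.add_mem (I.mul_mem_left _ (hx.2 i)) (I.mul_mem_right _ hx.1)⟩ }
  -- lifts of derivations
  have hlift : ∀ k, ∃ d : Derivation ℂ (MvPolynomial (Fin m) ℂ) (MvPolynomial (Fin m) ℂ),
      ∀ q, π (d q) = D k (π q) := by
    intro k
    choose g hg using fun j => hπ (D k (π (MvPolynomial.X j)))
    refine ⟨MvPolynomial.mkDerivation ℂ g, fun q => ?_⟩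
    induction q using MvPolynomial.induction_on with
    | C a =>
      rw [← MvPolynomial.algebraMap_eq, Derivation.map_algebraMap, map_zero, AlgHom.commutes,
        Derivation.map_algebraMap]
    | add p q hp hq => simp only [map_add, hp, hq]
    | mul_X p j hp =>
      simp only [Derivation.leibniz, map_add, map_mul, smul_eq_mul, hp,
        MvPolynomial.mkDerivation_X, hg]
  choose d hd using hlift
  have hdI : ∀ k, ∀ q ∈ I, d k q ∈ I := fun k q hq => by
    rw [RingHom.mem_ker] at hq ⊢
    rw [hd, hq, map_zero]
  have hdI2 : ∀ k, ∀ q ∈ I ^ 2, d k q ∈ I ^ 2 := by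
    intro k q hq
    rw [pow_two] at hq ⊢
    induction hq using Submodule.mul_induction_on' with
    | mem_mul_mem a ha b hb =>
      rw [Derivation.leibniz]
      exact Ideal.add_mem (I * I) (Ideal.mul_mem_mul (I := I) (J := I) ha (hdI k b hb)) (by
        rw [smul_eq_mul]; exact Ideal.mul_mem_mul (I := I) (J := I) hb (hdI k a ha))
    | add x _ y _ hx hy => rw [map_add]; exact Ideal.add_mem _ hx hy
  have hdH : ∀ k, ∀ h ∈ H, d k h ∈ H := by
    intro k h hh
    refine ⟨hdI k h hh.1, fun i => ?_⟩
    have h1 := aux_mem_comm I ⁅(MvPolynomial.pderiv i : Derivation ℂ _ (MvPolynomial (Fin m) ℂ)), d k⁆ h hh.2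
    rw [Derivation.commutator_apply] at h1
    have h2 := I.add_mem h1 (hdI k _ (hh.2 i))
    rwa [sub_add_cancel] at h2
  -- the annihilator
  let J : Ideal R := (Submodule.colon (I ^ 2) (H : Set _)).map π
  have hIJ : I ≤ Submodule.colon (I ^ 2) (H : Set _) := by
    intro q hq
    rw [Submodule.mem_colon]
    intro h hh
    rw [pow_two]
    exact Ideal.mul_mem_mul hq hh.1
  have hJ : ∀ q, π q ∈ J → q ∈ Submodule.colon (I ^ 2) (H : Set _) := by
    intro q hq
    obtain ⟨q', hq', h⟩ := (Ideal.mem_map_iff_of_surjective π hπ).mp hq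
    have : q - q' ∈ I := by rw [RingHom.mem_ker, map_sub, h, sub_self]
    simpa using Ideal.add_mem _ (hIJ this) hq'
  have hJtop : J = ⊤ := by
    refine aux_ideal_eq_top_of_deriv D hD J ?_ ?_
    · intro k a ha
      obtain ⟨q, rfl⟩ := hπ a
      have hq := hJ q ha
      rw [← hd]
      refine Ideal.mem_map_of_mem _ ?_
      rw [Submodule.mem_colon] at hq ⊢
      intro h hh
      have h1 := hdI2 k _ (hq h hh)
      rw [smul_eq_mul, Derivation.leibniz] at h1
      have h2 := Ideal.sub_mem _ h1 (hq _ (hdH k h hh))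
      simpa [mul_comm] using h2
    · -- nonzero
      have hfs : Algebra.FormallySmooth ℂ (FractionRing R) := by
        have : Algebra.EssFiniteType ℂ (FractionRing R) := Algebra.EssFiniteType.comp ℂ R _
        infer_instance
      have hsub : Subsingleton (Algebra.H1Cotangent ℂ (FractionRing R)) := inferInstance
      have hloc := Algebra.H1Cotangent.isLocalizedModule ℂ (S := R) (T := FractionRing R)
        (nonZeroDivisors R)
      have hkill : ∀ h ∈ H, ∃ q, π q ≠ 0 ∧ q * h ∈ I ^ 2 := by
        intro h hh
        have hhk : h ∈ P.toExtension.ker := by rw [hker]; exact hh.1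
        let c : P.toExtension.H1Cotangent := ⟨.mk ⟨h, hhk⟩, by
          rw [LinearMap.mem_ker]
          refine (aux_h1_elem P h hhk).mpr fun i => ?_
          rw [hval]; exact hh.2 i⟩
        obtain ⟨s, hs⟩ := (IsLocalizedModule.eq_zero_iff (nonZeroDivisors R)
          (Algebra.H1Cotangent.map ℂ ℂ R (FractionRing R)) (m := P.equivH1Cotangent c)).mp
            (Subsingleton.elim _ _)
        have hs' : (s : R) • c = 0 := by
          apply P.equivH1Cotangent.injective
          rw [map_smul, map_zero]; exact hs
        obtain ⟨q, hq⟩ := hπ (s : R)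
        refine ⟨q, by rw [hq]; exact nonZeroDivisors.coe_ne_zero s, ?_⟩
        have h3 : (s : R) • (Algebra.Extension.Cotangent.mk ⟨h, hhk⟩ : P.toExtension.Cotangent) = 0 :=
          congrArg Subtype.val hs'
        rw [← hker]
        refine aux_smul_mk P h hhk q ?_
        rw [← h3, ← hq, ← hval]
      obtain ⟨S, hS⟩ := (inferInstance : IsNoetherian _ (MvPolynomial (Fin m) ℂ)).noetherian H
      choose! f hf0 hf using hkill
      have hmem : ∏ s ∈ S, f s ∈ Submodule.colon (I ^ 2) (H : Set _) := by
        rw [← hS, Submodule.colon_span, Submodule.mem_colon]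
        intro h hh
        rw [← Finset.mul_prod_erase _ _ hh, smul_eq_mul, mul_right_comm]
        exact Ideal.mul_mem_right _ _ (hf h (hS ▸ Submodule.subset_span hh))
      intro h0
      have := Ideal.mem_map_of_mem π hmem
      change _ ∈ J at this
      rw [h0, Ideal.mem_bot, map_prod, Finset.prod_eq_zero_iff] at this
      obtain ⟨s, hs, h1⟩ := this
      exact hf0 s (hS ▸ Submodule.subset_span hs) h1
  have hH : H ≤ I ^ 2 := by
    intro h hh
    have : (1 : MvPolynomial (Fin m) ℂ) ∈ Submodule.colon (I ^ 2) (H : Set _) :=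
      hJ 1 (by rw [hJtop]; trivial)
    simpa using (Submodule.mem_colon.mp this) h hh
  rw [← P.equivH1Cotangent.toEquiv.subsingleton_congr]
  rw [Algebra.Extension.subsingleton_h1Cotangent]
  rw [injective_iff_map_eq_zero]
  intro x hx
  obtain ⟨⟨h, hhk⟩, rfl⟩ := Algebra.Extension.Cotangent.mk_surjective x
  refine (aux_mk_eq_zero P h hhk).mpr ?_
  rw [hker]
  apply hH
  refine ⟨hker ▸ hhk, fun i => ?_⟩
  rw [RingHom.mem_ker, ← hval]
  exact (aux_h1_elem P h hhk).mp hx i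

theorem aux_exists_poly {P R : Type} [CommRing P] [CommRing R] [IsDomain P] [CharZero P] [Algebra P R]
    (I : Ideal R) (hI : I.comap (algebraMap P R) = ⊥) (r : R)
    (hr : ∃ h : Polynomial P, h ≠ 0 ∧ Polynomial.aeval r h ∈ I) :
    ∃ h : Polynomial P, Polynomial.aeval r h ∈ I ∧
      Polynomial.aeval r (Polynomial.derivative h) ∉ I := by
  classical
  have hex : ∃ N, ∃ h : Polynomial P, h ≠ 0 ∧ Polynomial.aeval r h ∈ I ∧ h.natDegree = N := by
    obtain ⟨h, h1, h2⟩ := hr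
    exact ⟨_, h, h1, h2, rfl⟩
  obtain ⟨h, h0, h1, h2⟩ := Nat.find_spec hex
  refine ⟨h, h1, fun h3 => ?_⟩
  by_cases hd : h.derivative = 0
  · have := Polynomial.derivative_eq_zero.mp hd
    rw [Polynomial.eq_C_of_natDegree_eq_zero this, Polynomial.aeval_C] at h1
    have h4 : h.coeff 0 ∈ I.comap (algebraMap P R) := h1
    rw [hI, Ideal.mem_bot] at h4
    rw [Polynomial.eq_C_of_natDegree_eq_zero this, h4] at h0
    simp at h0
  · refine Nat.find_min hex (m := h.derivative.natDegree) ?_ ⟨_, hd, h3, rfl⟩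
    rw [← h2]
    refine Polynomial.natDegree_derivative_lt (fun h5 => ?_)
    exact hd (Polynomial.derivative_of_natDegree_zero h5)

theorem aux_kaehler_zero {n : ℕ} {R : Type} [CommRing R] [IsDomain R] [Algebra ℂ R]
    [Algebra.FiniteType ℂ R]
    [Algebra (MvPolynomial (Fin n) ℂ) R] [IsScalarTower ℂ (MvPolynomial (Fin n) ℂ) R]
    [Algebra.IsAlgebraic (MvPolynomial (Fin n) ℂ) R]
    (D : Fin n → Derivation ℂ R R)
    (hD : ∀ i j, D i (algebraMap _ R (MvPolynomial.X j : MvPolynomial (Fin n) ℂ)) =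
      if i = j then 1 else 0) : Subsingleton (Ω[R⁄MvPolynomial (Fin n) ℂ]) := by
  have hinj := aux_algebraMap_injective D hD
  have hft : Algebra.FiniteType (MvPolynomial (Fin n) ℂ) R :=
    Algebra.FiniteType.of_restrictScalars_finiteType ℂ _ _
  have hfin : Module.Finite R (Ω[R⁄MvPolynomial (Fin n) ℂ]) := inferInstance
  have htors : Module.IsTorsion R (Ω[R⁄MvPolynomial (Fin n) ℂ]) := by
    intro w
    have hw : w ∈ Submodule.span R (Set.range (KaehlerDifferential.D (MvPolynomial (Fin n) ℂ) R)) := by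
      rw [KaehlerDifferential.span_range_derivation]; trivial
    induction hw using Submodule.span_induction with
    | mem x hx =>
      obtain ⟨r, rfl⟩ := hx
      obtain ⟨h, h1, h2⟩ := aux_exists_poly (P := MvPolynomial (Fin n) ℂ) (⊥ : Ideal R)
        ((RingHom.injective_iff_ker_eq_bot _).mp hinj) r (by
          obtain ⟨h, h1, h2⟩ := Algebra.IsAlgebraic.isAlgebraic (R := MvPolynomial (Fin n) ℂ) r
          exact ⟨h, h1, h2⟩)
      rw [Ideal.mem_bot] at h1 h2
      refine ⟨⟨_, mem_nonZeroDivisors_of_ne_zero h2⟩, ?_⟩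
      change Polynomial.aeval r (Polynomial.derivative h) • KaehlerDifferential.D (MvPolynomial (Fin n) ℂ) R r = 0
      rw [← Derivation.map_aeval, h1, map_zero]
    | zero => exact ⟨1, by simp⟩
    | add x y _ _ hx hy =>
      obtain ⟨a, ha⟩ := hx
      obtain ⟨b, hb⟩ := hy
      exact ⟨a * b, by rw [smul_add, mul_smul, mul_smul, hb, smul_comm a b, ha]; simp⟩
    | smul b x _ hx =>
      obtain ⟨a, ha⟩ := hx
      exact ⟨a, by rw [smul_comm, ha, smul_zero]⟩
  have htop : Module.annihilator R (Ω[R⁄MvPolynomial (Fin n) ℂ]) = ⊤ := by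
    refine aux_ideal_eq_top_of_deriv D hD _ ?_ ?_
    · intro i a ha
      rw [Module.mem_annihilator] at ha ⊢
      exact aux_kaehler_ann (D i) (fun p => ⟨_, aux_deriv_algebraMap D hD i p⟩) a ha
    · obtain ⟨a, ha, ha'⟩ := Submodule.annihilator_top_inter_nonZeroDivisors htors
      intro h
      rw [Submodule.annihilator_top, h] at ha
      exact nonZeroDivisors.ne_zero ha' ha
  refine ⟨fun x y => ?_⟩
  have h1 : (1 : R) ∈ Module.annihilator R (Ω[R⁄MvPolynomial (Fin n) ℂ]) := by rw [htop]; trivial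
  rw [Module.mem_annihilator] at h1
  rw [← one_smul R x, ← one_smul R y, h1, h1]

open TensorProduct in
theorem smooth_of_derivations {n : ℕ} {R : Type} [CommRing R] [IsDomain R] [Algebra ℂ R]
    [Algebra.FiniteType ℂ R]
    [Algebra (MvPolynomial (Fin n) ℂ) R] [IsScalarTower ℂ (MvPolynomial (Fin n) ℂ) R]
    [Algebra.IsAlgebraic (MvPolynomial (Fin n) ℂ) R]
    (D : Fin n → Derivation ℂ R R)
    (hD : ∀ i j, D i (algebraMap _ R (MvPolynomial.X j : MvPolynomial (Fin n) ℂ)) =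
      if i = j then 1 else 0) : Algebra.Smooth ℂ R := by
  have h1 := aux_h1 D hD
  have h2 := aux_kaehler_zero D hD
  let v : Fin n → Ω[R⁄ℂ] := fun i => KaehlerDifferential.D ℂ R (algebraMap _ R
    (MvPolynomial.X i : MvPolynomial (Fin n) ℂ))
  have hli : LinearIndependent R v := by
    rw [Fintype.linearIndependent_iff]
    intro g hg i
    have := congrArg (D i).liftKaehlerDifferential hg
    simpa [v, map_sum, Derivation.liftKaehlerDifferential_comp_D, hD] using this
  have hsp : ⊤ ≤ Submodule.span R (Set.range v) := by
    intro w _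
    have : w ∈ LinearMap.range (KaehlerDifferential.mapBaseChange ℂ (MvPolynomial (Fin n) ℂ) R) := by
      rw [KaehlerDifferential.range_mapBaseChange]
      exact Subsingleton.elim _ _
    obtain ⟨t, rfl⟩ := this
    induction t using TensorProduct.induction_on with
    | zero => simp
    | add x y hx hy => rw [map_add]; exact Submodule.add_mem _ (hx trivial) (hy trivial)
    | tmul r w =>
      rw [KaehlerDifferential.mapBaseChange_tmul]
      refine Submodule.smul_mem _ _ ?_
      rw [← (KaehlerDifferential.mvPolynomialBasis ℂ (Fin n)).sum_repr w, map_sum]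
      refine Submodule.sum_mem _ fun i _ => ?_
      rw [map_smul, ← algebraMap_smul R, KaehlerDifferential.mvPolynomialBasis_apply]
      refine Submodule.smul_mem _ _ (Submodule.subset_span ⟨i, ?_⟩)
      simp [v]
  have : Module.Free R (Ω[R⁄ℂ]) := Module.Free.of_basis (Module.Basis.mk hli hsp)
  exact ⟨⟨inferInstance, h1⟩, Algebra.FinitePresentation.of_finiteType.mp inferInstance⟩

/-- elementwise uniformizer -/
def AuxUnif {S : Type} [CommRing S] (Q : Ideal S) (t : S) : Prop :=
  t ∈ Q ∧ t ≠ 0 ∧ ∀ a ∈ Q, ∃ σ, σ ∉ Q ∧ ∃ b, σ * a = t * b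

/-- elements of `K` that lie in the local ring at `Q` -/
def auxLoc {R : Type} [CommRing R] (Q : Ideal R) [hQ : Q.IsPrime] (K : Type) [Field K]
    [Algebra R K] : Subring K where
  carrier := {x | ∃ σ, σ ∉ Q ∧ ∃ r, algebraMap R K σ * x = algebraMap R K r}
  zero_mem' := ⟨1, hQ.one_notMem, 0, by simp⟩
  one_mem' := ⟨1, hQ.one_notMem, 1, by simp⟩
  add_mem' := by
    rintro x y ⟨σ, hσ, r, hr⟩ ⟨τ, hτ, s, hs⟩
    refine ⟨σ * τ, hQ.mul_notMem hσ hτ, τ * r + σ * s, ?_⟩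
    simp only [map_mul, map_add, ← hr, ← hs]; ring
  mul_mem' := by
    rintro x y ⟨σ, hσ, r, hr⟩ ⟨τ, hτ, s, hs⟩
    refine ⟨σ * τ, hQ.mul_notMem hσ hτ, r * s, ?_⟩
    simp only [map_mul, ← hr, ← hs]; ring
  neg_mem' := by
    rintro x ⟨σ, hσ, r, hr⟩
    exact ⟨σ, hσ, -r, by simp [← hr]⟩

theorem auxLoc_algebraMap_mem {R : Type} [CommRing R] (Q : Ideal R) [hQ : Q.IsPrime] (K : Type)
    [Field K] [Algebra R K] (r : R) : algebraMap R K r ∈ auxLoc Q K :=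
  ⟨1, hQ.one_notMem, r, by simp⟩

theorem auxLoc_mem_of_mul_mem {R : Type} [CommRing R] (Q : Ideal R) [hQ : Q.IsPrime] (K : Type)
    [Field K] [Algebra R K] (σ : R) (hσ : σ ∉ Q) (x : K)
    (hx : algebraMap R K σ * x ∈ auxLoc Q K) : x ∈ auxLoc Q K := by
  obtain ⟨τ, hτ, r, hr⟩ := hx
  exact ⟨τ * σ, hQ.mul_notMem hτ hσ, r, by rw [map_mul, mul_assoc, hr]⟩

theorem AuxUnif.exists_pow {S : Type} [CommRing S] [IsDomain S] [IsNoetherianRing S]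
    {Q : Ideal S} [hQ : Q.IsPrime] {t : S} (h : AuxUnif Q t) (x : S) (hx : x ≠ 0) :
    ∃ (e : ℕ) (s s' : S), s ∉ Q ∧ s' ∉ Q ∧ s * x = s' * t ^ e := by
  let I : S → Ideal S := fun x =>
    { carrier := {a | ∃ σ, σ ∉ Q ∧ x ∣ σ * a}
      zero_mem' := ⟨1, hQ.one_notMem, by simp⟩
      add_mem' := by
        rintro a b ⟨σ, hσ, h1⟩ ⟨τ, hτ, h2⟩
        refine ⟨σ * τ, hQ.mul_notMem hσ hτ, ?_⟩
        have : σ * τ * (a + b) = τ * (σ * a) + σ * (τ * b) := by ring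
        rw [this]
        exact dvd_add (h1.mul_left _) (h2.mul_left _)
      smul_mem' := by
        rintro c a ⟨σ, hσ, h1⟩
        refine ⟨σ, hσ, ?_⟩
        rw [smul_eq_mul, mul_left_comm]
        exact h1.mul_left _ }
  induction hI : I x using WellFoundedGT.induction generalizing x with
  | _ J ih =>
  by_cases hxQ : x ∈ Q
  · obtain ⟨ht, ht0, h1⟩ := id h
    obtain ⟨σ, hσ, y, hy⟩ := h1 x hxQ
    have hσ0 : σ ≠ 0 := fun h => hσ (h ▸ Q.zero_mem)
    have hy0 : y ≠ 0 := by
      rintro rfl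
      rw [mul_zero] at hy
      exact (mul_ne_zero hσ0 hx) hy
    have hlt : J < I y := by
      rw [← hI]
      refine lt_of_le_of_ne ?_ ?_
      · rintro a ⟨τ, hτ, c, hc⟩
        exact ⟨τ * σ, hQ.mul_notMem hτ hσ, t * c, by
          calc τ * σ * a = σ * (τ * a) := by ring
            _ = (σ * x) * c := by rw [hc]; ring
            _ = y * (t * c) := by rw [hy]; ring⟩
      · intro heq
        have : y ∈ I x := by rw [heq]; exact ⟨1, hQ.one_notMem, by simp⟩
        obtain ⟨τ, hτ, c, hc⟩ := this
        have h3 : (σ * τ) * y = (t * c) * y := by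
          calc (σ * τ) * y = σ * (τ * y) := by ring
            _ = (σ * x) * c := by rw [hc]; ring
            _ = (t * c) * y := by rw [hy]; ring
        have h4 := mul_right_cancel₀ hy0 h3
        exact hQ.mul_notMem hσ hτ (h4 ▸ Q.mul_mem_right _ ht)
    obtain ⟨e, s, s', hs, hs', h5⟩ := ih _ hlt y hy0 rfl
    refine ⟨e + 1, s * σ, s', hQ.mul_notMem hs hσ, hs', ?_⟩
    calc s * σ * x = s * (σ * x) := by ring
      _ = t * (s * y) := by rw [hy]; ring
      _ = _ := by rw [h5]; ring
  · exact ⟨0, 1, x, hQ.one_notMem, hxQ, by simp⟩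

theorem AuxUnif.eq_of_le {S : Type} [CommRing S] [IsDomain S] [IsNoetherianRing S]
    {Q : Ideal S} [hQ : Q.IsPrime] {t : S} (h : AuxUnif Q t) (Q' : Ideal S) [hQ' : Q'.IsPrime]
    (hle : Q' ≤ Q) (x : S) (hx : x ∈ Q') (hx0 : x ≠ 0) : Q' = Q := by
  obtain ⟨e, s, s', hs, hs', h5⟩ := h.exists_pow x hx0
  have ht : t ∈ Q' := by
    have : s' * t ^ e ∈ Q' := h5 ▸ Q'.mul_mem_left _ hx
    rcases hQ'.mem_or_mem this with h | h
    · exact absurd (hle h) hs'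
    · exact hQ'.mem_of_pow_mem _ h
  refine le_antisymm hle fun a ha => ?_
  obtain ⟨σ, hσ, b, hb⟩ := h.2.2 a ha
  have : σ * a ∈ Q' := hb ▸ Q'.mul_mem_right _ ht
  exact (hQ'.mem_or_mem this).resolve_left fun h => hσ (hle h)

theorem AuxUnif.mem_minimalPrimes {S : Type} [CommRing S] [IsDomain S] [IsNoetherianRing S]
    {Q : Ideal S} [hQ : Q.IsPrime] {t : S} (h : AuxUnif Q t) (x : S) (hx : x ∈ Q) (hx0 : x ≠ 0) :
    Q ∈ (Ideal.span {x}).minimalPrimes := by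
  refine ⟨⟨hQ, by simpa using hx⟩, ?_⟩
  rintro Q' ⟨h1, h2⟩ hle
  exact (h.eq_of_le Q' hle x (h2 (Ideal.mem_span_singleton_self x)) hx0).ge

/-- Transfer of uniformizers to overrings with the same fraction field. -/
theorem AuxUnif.transfer {S R : Type} [CommRing S] [IsDomain S] [IsNoetherianRing S]
    [CommRing R] [IsDomain R] [Algebra S R] (hinj : Function.Injective (algebraMap S R))
    (hfrac : ∀ r : R, ∃ s : S, s ≠ 0 ∧ ∃ a : S, algebraMap S R s * r = algebraMap S R a)
    (Q : Ideal R) [hQ : Q.IsPrime] (w : S) (h : AuxUnif (Q.comap (algebraMap S R)) w) :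
    AuxUnif Q (algebraMap S R w) := by
  refine ⟨h.1, fun h0 => h.2.1 (hinj (by rw [h0, map_zero])), fun r hr => ?_⟩
  obtain ⟨b, hb, a, ha⟩ := hfrac r
  by_cases hr0 : r = 0
  · exact ⟨1, hQ.one_notMem, 0, by simp [hr0]⟩
  have hb' : algebraMap S R b ≠ 0 := fun h0 => hb (hinj (by rw [h0, map_zero]))
  have ha0 : a ≠ 0 := by
    rintro rfl
    rw [map_zero] at ha
    exact mul_ne_zero hb' hr0 ha
  have hw0 : algebraMap S R w ≠ 0 := fun h0 => h.2.1 (hinj (by rw [h0, map_zero]))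
  obtain ⟨i, σ, α, hσ, hα, h1⟩ := h.exists_pow a ha0
  obtain ⟨j, τ, β, hτ, hβ, h2⟩ := h.exists_pow b hb
  have h1' := congrArg (algebraMap S R) h1
  have h2' := congrArg (algebraMap S R) h2
  simp only [map_mul, map_pow] at h1' h2'
  rw [Ideal.mem_comap] at hσ hα hτ hβ
  have key : (algebraMap S R τ * algebraMap S R α) * algebraMap S R w ^ i =
      r * (algebraMap S R σ * algebraMap S R β) * algebraMap S R w ^ j := by
    calc _ = algebraMap S R τ * (algebraMap S R α * algebraMap S R w ^ i) := by ring
      _ = algebraMap S R σ * r * (algebraMap S R τ * algebraMap S R b) := by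
        rw [← h1', ← ha]; ring
      _ = _ := by rw [h2']; ring
  rcases lt_or_ge j i with hij | hij
  · obtain ⟨k, rfl⟩ := Nat.exists_eq_add_of_lt hij
    refine ⟨algebraMap S R σ * algebraMap S R β, hQ.mul_notMem hσ hβ,
      (algebraMap S R τ * algebraMap S R α) * algebraMap S R w ^ k, ?_⟩
    refine mul_right_cancel₀ (pow_ne_zero j hw0) ?_
    rw [mul_comm _ r, ← key]; ring
  · obtain ⟨k, rfl⟩ := Nat.exists_eq_add_of_le hij
    exfalso
    have : algebraMap S R τ * algebraMap S R α =
        r * (algebraMap S R σ * algebraMap S R β * algebraMap S R w ^ k) := by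
      refine mul_right_cancel₀ (pow_ne_zero i hw0) ?_
      rw [key]; ring
    exact hQ.mul_notMem hτ hα (this ▸ Q.mul_mem_right _ hr)

/-- existence of uniformizers at denominators -/
theorem aux_exists_unif {A L : Type} [CommRing A] [IsDomain A] [IsNoetherianRing A]
    [IsIntegrallyClosed A] [Field L] [Algebra A L] [IsFractionRing A L] (x : L)
    (hx : x ∉ Set.range (algebraMap A L)) :
    ∃ (p : Ideal A) (_ : p.IsPrime) (t : A), AuxUnif p t ∧
      ∀ a, algebraMap A L a * x ∈ Set.range (algebraMap A L) → a ∈ p := by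
  let M := L ⧸ (LinearMap.range (Algebra.linearMap A L))
  have hmk : ∀ y : L, (Submodule.Quotient.mk y : M) = 0 ↔ y ∈ Set.range (algebraMap A L) := by
    intro y
    rw [Submodule.Quotient.mk_eq_zero]; rfl
  obtain ⟨p, hp, hle⟩ := exists_le_isAssociatedPrime_of_isNoetherianRing A
    (Submodule.Quotient.mk x : M) (fun h => hx ((hmk x).mp h))
  rw [isAssociatedPrime_iff] at hp
  obtain ⟨hprime, y, hy⟩ := hp
  obtain ⟨y, rfl⟩ := Submodule.Quotient.mk_surjective _ y
  have hcol : ∀ (z : L) (a : A), a ∈ (⊥ : Submodule A M).colon {(Submodule.Quotient.mk z : M)} ↔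
      algebraMap A L a * z ∈ Set.range (algebraMap A L) := by
    intro z a
    rw [Submodule.mem_colon_singleton, Submodule.mem_bot, ← Submodule.Quotient.mk_smul, hmk,
      Algebra.smul_def]
  have hden : ∀ a, a ∈ p ↔ algebraMap A L a * y ∈ Set.range (algebraMap A L) := by
    intro a
    rw [hy, hcol]
  have hden2 : ∀ a, algebraMap A L a * x ∈ Set.range (algebraMap A L) → a ∈ p := by
    intro a ha
    exact hle ((hcol x a).mpr ha)
  have hyA : y ∉ Set.range (algebraMap A L) := by
    intro h
    exact hprime.one_notMem ((hden 1).mpr (by simpa using h))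
  have hinj := IsFractionRing.injective A L
  -- some nonzero element of p
  obtain ⟨b, hb0, hbp⟩ : ∃ b, b ≠ 0 ∧ b ∈ p := by
    obtain ⟨a, b, hb, h⟩ := IsFractionRing.div_surjective (A := A) y
    have hb0 : b ≠ 0 := nonZeroDivisors.ne_zero hb
    refine ⟨b, hb0, (hden b).mpr ⟨a, ?_⟩⟩
    rw [← h, mul_div_cancel₀]
    exact fun h0 => hb0 (hinj (by rw [h0, map_zero]))
  have hex : ∃ t ∈ p, ∃ s, s ∉ p ∧ algebraMap A L t * y = algebraMap A L s := by
    by_contra! hcon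
    apply hyA
    have hint : IsIntegral A y := by
      refine isIntegral_of_smul_mem_submodule (Submodule.map (Algebra.linearMap A L) p) ?_
        (Submodule.FG.map _ (IsNoetherian.noetherian p)) y ?_
      · rw [Submodule.ne_bot_iff]
        refine ⟨_, ⟨b, hbp, rfl⟩, ?_⟩
        exact fun h0 => hb0 (hinj (h0.trans (map_zero _).symm))
      · rintro _ ⟨a, ha, rfl⟩
        obtain ⟨s, hs⟩ := (hden a).mp ha
        refine ⟨s, ?_, ?_⟩
        · by_contra hsp
          exact hcon a ha s hsp hs.symm
        · change algebraMap A L s = y * algebraMap A L a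
          rw [hs, mul_comm]
    exact IsIntegrallyClosed.algebraMap_eq_of_integral hint
  obtain ⟨t, htp, s, hs, hts⟩ := hex
  refine ⟨p, hprime, t, ⟨htp, ?_, fun a ha => ?_⟩, hden2⟩
  · rintro rfl
    rw [map_zero, zero_mul] at hts
    exact hs (by rw [hinj (hts.symm.trans (map_zero _).symm)]; exact p.zero_mem)
  · obtain ⟨c, hc⟩ := (hden a).mp ha
    refine ⟨s, hs, c, hinj ?_⟩
    rw [map_mul, map_mul, ← hts, hc]; ring

theorem aux_descend {A L L' R : Type} [CommRing A] [IsDomain A] [IsNoetherianRing A]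
    [IsIntegrallyClosed A] [Field L] [Algebra A L] [IsFractionRing A L]
    [Field L'] [Algebra L L'] [Algebra A L'] [IsScalarTower A L L'] [FiniteDimensional L L']
    [CommRing R] [Algebra A R] [Algebra R L'] [IsScalarTower A R L'] [IsIntegralClosure R A L']
    (x : L') (hx : ∀ (p : Ideal A) (_ : p.IsPrime) (t : A), AuxUnif p t →
      ∀ (Q : Ideal R) (_ : Q.IsPrime), Q.comap (algebraMap A R) = p → x ∈ auxLoc Q L') :
    ∃ r, algebraMap R L' r = x := by
  have hAR : Algebra.IsIntegral A R := IsIntegralClosure.isIntegral_algebra A L'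
  have hxi : IsIntegral L x := Algebra.IsIntegral.isIntegral x
  -- denominators
  have hden : ∀ (p : Ideal A) (_ : p.IsPrime) (t : A), AuxUnif p t →
      ∃ σ, σ ∉ p ∧ IsIntegral A (algebraMap A L' σ * x) := by
    intro p hp t ht
    let I : Ideal R :=
      { carrier := {r | ∃ s, algebraMap R L' r * x = algebraMap R L' s}
        zero_mem' := ⟨0, by simp⟩
        add_mem' := by
          rintro a b ⟨s, hs⟩ ⟨s', hs'⟩
          exact ⟨s + s', by rw [map_add, add_mul, hs, hs', map_add]⟩
        smul_mem' := by
          rintro c a ⟨s, hs⟩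
          exact ⟨c * s, by rw [smul_eq_mul, map_mul, mul_assoc, hs, map_mul]⟩ }
    have hI : ¬ I.comap (algebraMap A R) ≤ p := by
      intro hle
      obtain ⟨Q, hQI, hQ, hQp⟩ := Ideal.exists_ideal_over_prime_of_isIntegral p I hle
      obtain ⟨σ, hσ, r, hr⟩ := hx p hp t ht Q hQ hQp
      exact hσ (hQI ⟨r, hr⟩)
    obtain ⟨σ, hσ, hσp⟩ := Set.not_subset.mp hI
    obtain ⟨s, hs⟩ := hσ
    refine ⟨σ, hσp, ?_⟩
    rw [← IsScalarTower.algebraMap_apply] at hs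
    rw [hs]
    exact (Algebra.IsIntegral.isIntegral (R := A) s).algebraMap
  -- coefficients
  have hco : ∀ i, (minpoly L x).coeff i ∈ Set.range (algebraMap A L) := by
    intro i
    by_contra hcon
    obtain ⟨p, hp, t, ht, hpd⟩ := aux_exists_unif _ hcon
    obtain ⟨σ, hσ, hint⟩ := hden p hp t ht
    have hσ0 : algebraMap A L σ ≠ 0 := by
      intro h0
      apply hσ
      rw [IsFractionRing.injective A L (h0.trans (map_zero _).symm)]
      exact p.zero_mem
    have h1 : minpoly L (algebraMap A L' σ * x) = (minpoly L x).scaleRoots (algebraMap A L σ) := by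
      rw [← IsIntegrallyClosed.minpoly_smul hσ0 hxi, Algebra.smul_def,
        ← IsScalarTower.algebraMap_apply]
    have h2 := minpoly.isIntegrallyClosed_eq_field_fractions L L' hint
    rw [Algebra.algebraMap_self_apply, h1] at h2
    have h3 := congrArg (fun q => Polynomial.coeff q i) h2
    simp only [Polynomial.coeff_scaleRoots, Polynomial.coeff_map] at h3
    refine hσ (hp.mem_of_pow_mem ((minpoly L x).natDegree - i) (hpd _ ⟨(minpoly A (algebraMap A L' σ * x)).coeff i, ?_⟩))
    rw [← h3, map_pow, mul_comm]
  have hxA : IsIntegral A x := by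
    have hlift : minpoly L x ∈ Polynomial.lifts (algebraMap A L) :=
      (Polynomial.lifts_iff_coeff_lifts _).mpr hco
    obtain ⟨q, hq, hdeg, hmon⟩ := Polynomial.lifts_and_natDegree_eq_and_monic hlift
      (minpoly.monic hxi)
    refine ⟨q, hmon, ?_⟩
    have := minpoly.aeval L x
    rw [← hq, Polynomial.aeval_map_algebraMap] at this
    exact this
  exact IsIntegralClosure.isIntegral_iff.mp hxA

theorem aux_deriv_aeval {k B R K : Type} [CommRing k] [CommRing B] [CommRing R] [Field K]
    [Algebra k K] [Algebra B R] [Algebra R K]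
    (D : Derivation k K K) (Q : Ideal R) [hQ : Q.IsPrime]
    (hB : ∀ b : B, D (algebraMap R K (algebraMap B R b)) ∈ auxLoc Q K) (r : R) (h : Polynomial B) :
    D (algebraMap R K (Polynomial.aeval r h)) -
      algebraMap R K (Polynomial.aeval r h.derivative) * D (algebraMap R K r) ∈ auxLoc Q K := by
  induction h using Polynomial.induction_on' with
  | add p q hp hq =>
    convert add_mem hp hq using 1
    simp only [map_add]; ring
  | monomial n a =>
    rw [Polynomial.aeval_monomial, Polynomial.derivative_monomial, Polynomial.aeval_monomial]
    simp only [map_mul, map_pow, Derivation.leibniz, Derivation.leibniz_pow, smul_eq_mul,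
      nsmul_eq_mul, map_natCast]
    convert mul_mem (pow_mem (auxLoc_algebraMap_mem Q K r) n) (hB a) using 1
    ring

theorem aux_deriv_local {k B R K : Type} [CommRing k] [CommRing B] [Algebra ℂ B] [CommRing R]
    [IsDomain R] [IsNoetherianRing R] [Field K]
    [Algebra k K] [Algebra B R] [Module.Finite B R] [Algebra R K] [IsFractionRing R K]
    (D : Derivation k K K) (Q : Ideal R) [hQ : Q.IsPrime] (w : R) (hw : AuxUnif Q w)
    (hDw : D (algebraMap R K w) ∈ auxLoc Q K)
    (hB : ∀ b : B, D (algebraMap R K (algebraMap B R b)) ∈ auxLoc Q K) (r : R) :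
    D (algebraMap R K r) ∈ auxLoc Q K := by
  -- existence of a polynomial
  have hpoly : ∀ r : R, ∃ h : Polynomial B, Polynomial.aeval r h ∈ Q ∧
      Polynomial.aeval r h.derivative ∉ Q := by
    intro r
    classical
    have hex : ∃ N, ∃ h : Polynomial B, Polynomial.aeval r h ∈ Q ∧ h.natDegree ≤ N ∧
        algebraMap B R (h.coeff N) ∉ Q := by
      obtain ⟨h, h1, h2⟩ := Algebra.IsIntegral.isIntegral (R := B) r
      refine ⟨h.natDegree, h, ?_, le_rfl, ?_⟩
      · change Polynomial.aeval r h = 0 at h2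
        rw [h2]; exact Q.zero_mem
      · rw [h1.coeff_natDegree, map_one]; exact hQ.one_notMem
    obtain ⟨h, h1, h2, h3⟩ := Nat.find_spec hex
    refine ⟨h, h1, fun h4 => ?_⟩
    obtain h0 | ⟨N, hN⟩ : Nat.find hex = 0 ∨ ∃ N, Nat.find hex = N + 1 := by
      cases Nat.find hex <;> simp
    · rw [h0] at h2 h3
      rw [Polynomial.eq_C_of_natDegree_le_zero h2, Polynomial.aeval_C] at h1
      exact h3 h1
    · refine Nat.find_min hex (m := N) (by omega) ⟨h.derivative, h4, ?_, ?_⟩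
      · have := Polynomial.natDegree_derivative_le h
        omega
      · rw [Polynomial.coeff_derivative, map_mul, ← hN]
        refine hQ.mul_notMem h3 fun h5 => hQ.one_notMem ?_
        have h6 : algebraMap ℂ B (N + 1 : ℂ) * algebraMap ℂ B ((N + 1 : ℂ)⁻¹) = 1 := by
          rw [← map_mul, mul_inv_cancel₀ (Nat.cast_add_one_ne_zero N), map_one]
        have h7 := Q.mul_mem_right (algebraMap B R (algebraMap ℂ B ((N + 1 : ℂ)⁻¹))) h5
        rw [← map_mul] at h7
        rw [map_add, map_natCast, map_one] at h6
        rwa [h6, map_one] at h7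
  -- bounded denominators
  have hbd : ∃ m : ℕ, ∀ r, algebraMap R K w ^ m * D (algebraMap R K r) ∈ auxLoc Q K := by
    classical
    obtain ⟨S, hS⟩ := (inferInstance : Module.Finite B R).fg_top
    obtain ⟨c, hc⟩ := IsLocalization.exist_integer_multiples_of_finset (nonZeroDivisors R)
      (S.image fun s => D (algebraMap R K s))
    have hc0 : (c : R) ≠ 0 := nonZeroDivisors.coe_ne_zero c
    have h1 : ∀ r : R, algebraMap R K c * D (algebraMap R K r) ∈ auxLoc Q K := by
      intro r
      have hr : r ∈ Submodule.span B (S : Set R) := by rw [hS]; trivial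
      induction hr using Submodule.span_induction with
      | mem x hx =>
        obtain ⟨a, ha⟩ := hc _ (Finset.mem_image_of_mem _ hx)
        rw [Algebra.smul_def] at ha
        rw [← ha]
        exact auxLoc_algebraMap_mem Q K a
      | zero => simpa using zero_mem _
      | add x y _ _ hx hy =>
        rw [map_add, map_add, mul_add]; exact add_mem hx hy
      | smul b x _ hx =>
        rw [Algebra.smul_def, map_mul, Derivation.leibniz, smul_eq_mul, smul_eq_mul, mul_add]
        refine add_mem ?_ (mul_mem (auxLoc_algebraMap_mem Q K _)
          (mul_mem (auxLoc_algebraMap_mem Q K _) (hB b)))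
        rw [mul_left_comm]
        exact mul_mem (auxLoc_algebraMap_mem Q K _) hx
    obtain ⟨m, σ, τ, hσ, hτ, h2⟩ := hw.exists_pow (c : R) hc0
    refine ⟨m, fun r => auxLoc_mem_of_mul_mem Q K τ hτ _ ?_⟩
    rw [← map_pow, ← mul_assoc, ← map_mul, ← h2, map_mul, mul_assoc]
    exact mul_mem (auxLoc_algebraMap_mem Q K _) (h1 r)
  obtain ⟨m, hm⟩ := hbd
  induction m generalizing r with
  | zero => simpa using hm r
  | succ m ih =>
    refine ih r fun r => ?_
    obtain ⟨h, h1, h2⟩ := hpoly r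
    obtain ⟨σ, hσ, v, hv⟩ := hw.2.2 _ h1
    have e1 := aux_deriv_aeval D Q hB r h
    set y := Polynomial.aeval r h
    have e2 := congrArg (fun x => D (algebraMap R K x)) hv
    simp only [map_mul, Derivation.leibniz, smul_eq_mul] at e2
    have e3 := congrArg (algebraMap R K) hv
    simp only [map_mul] at e3
    refine auxLoc_mem_of_mul_mem Q K _ (hQ.mul_notMem hσ (hQ.mul_notMem hσ h2)) _ ?_
    have e4 := hm v
    have e5 := hm σ
    have ew := auxLoc_algebraMap_mem Q K w
    have eσ := auxLoc_algebraMap_mem Q K σ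
    have ev := auxLoc_algebraMap_mem Q K v
    have e6 := sub_mem (sub_mem (add_mem (mul_mem eσ e4)
      (mul_mem (mul_mem eσ (pow_mem ew m)) (mul_mem ev hDw))) (mul_mem ev e5))
      (mul_mem (mul_mem (pow_mem eσ 2) (pow_mem ew m)) e1)
    convert e6 using 1
    simp only [map_mul]
    linear_combination (algebraMap R K σ * algebraMap R K w ^ m) * e2 -
      (algebraMap R K w ^ m * D (algebraMap R K σ)) * e3

theorem aux_natCast_isUnit {A : Type} [CommRing A] [Algebra ℂ A] (m : ℕ) (hm : 0 < m) :
    IsUnit (m : A) := by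
  have : IsUnit (m : ℂ) := isUnit_iff_ne_zero.mpr (by exact_mod_cast hm.ne')
  simpa using this.map (algebraMap ℂ A)

theorem aux_unram {A S : Type} [CommRing A] [Algebra ℂ A] [CommRing S] [IsDomain S] [Algebra A S]
    (T : Set S) (hTf : T.Finite) (hT : Algebra.adjoin A T = ⊤) (q : Ideal S) [hq : q.IsPrime]
    (hroot : ∀ g ∈ T, ∃ (m : ℕ) (c : A), 0 < m ∧ g ^ m = algebraMap A S c ∧ algebraMap A S c ∉ q)
    (hinj : Function.Injective (algebraMap A S))
    (t : A) (h : AuxUnif (q.comap (algebraMap A S)) t) : AuxUnif q (algebraMap A S t) := by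
  let p := q.comap (algebraMap A S)
  have hfin : Algebra.FiniteType A S := ⟨hTf.toFinset, by simpa using hT⟩
  let Sq := Localization.AtPrime q
  have hunr : Algebra.FormallyUnramified A Sq := by
    constructor
    have hD : ∀ x : Sq, KaehlerDifferential.D A Sq x = 0 := by
      have h1 : ∀ s : S, KaehlerDifferential.D A Sq (algebraMap S Sq s) = 0 := by
        let D1 : Derivation A S (Ω[Sq⁄A]) := (KaehlerDifferential.D A Sq).compAlgebraMap S
        have hT0 : Set.EqOn D1 (0 : Derivation A S (Ω[Sq⁄A])) T := by
          intro g hg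
          obtain ⟨m, c, hm, hgm, hc⟩ := hroot g hg
          have h2 : D1 (g ^ m) = 0 := by rw [hgm, Derivation.map_algebraMap]
          rw [Derivation.leibniz_pow] at h2
          have hg' : g ^ (m - 1) ∉ q := by
            intro hgq
            apply hc
            rw [← hgm]
            have : g ^ m = g ^ (m - 1) * g := by
              rw [← pow_succ, Nat.sub_add_cancel hm]
            rw [this]; exact q.mul_mem_right _ hgq
          have hu : IsUnit (algebraMap S Sq (algebraMap A S m * g ^ (m - 1))) := by
            rw [map_mul]
            refine IsUnit.mul ?_ ?_
            · exact ((aux_natCast_isUnit m hm).map (algebraMap A S)).map (algebraMap S Sq)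
            · exact IsLocalization.map_units Sq (⟨_, hg'⟩ : q.primeCompl)
          rw [← Nat.cast_smul_eq_nsmul S, smul_smul, ← IsScalarTower.algebraMap_smul Sq] at h2
          have : (algebraMap A S m : S) = m := by simp
          rw [this] at hu
          exact hu.smul_eq_zero.mp h2
        intro s
        have := Derivation.eqOn_adjoin hT0 (by rw [hT]; trivial : s ∈ Algebra.adjoin A T)
        exact this
      intro x
      obtain ⟨s, σ, rfl⟩ := IsLocalization.exists_mk'_eq q.primeCompl x
      have h3 := congrArg (KaehlerDifferential.D A Sq) (IsLocalization.mk'_spec Sq s σ)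
      rw [Derivation.leibniz, h1, h1, smul_zero, zero_add] at h3
      exact (IsLocalization.map_units Sq σ).smul_eq_zero.mp h3
    rw [← Submodule.subsingleton_iff Sq, ← subsingleton_iff_bot_eq_top,
      ← KaehlerDifferential.span_range_derivation A Sq, eq_comm, Submodule.span_eq_bot]
    rintro _ ⟨x, rfl⟩
    exact hD x
  have hlies : q.LiesOver p := ⟨rfl⟩
  letI := Localization.AtPrime.algebraOfLiesOver p q
  have hmax := ((Algebra.isUnramifiedAt_iff_map_eq A p q).mp hunr).2
  have hle : p.map (algebraMap A Sq) ≤ Ideal.span {algebraMap A Sq t} := by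
    rw [Ideal.map_le_iff_le_comap]
    intro a ha
    obtain ⟨σ, hσ, b, hb⟩ := h.2.2 a ha
    rw [Ideal.mem_comap, Ideal.mem_span_singleton]
    have hu : IsUnit (algebraMap A Sq σ) := by
      rw [IsScalarTower.algebraMap_apply A S Sq]
      exact IsLocalization.map_units Sq (⟨_, hσ⟩ : q.primeCompl)
    rw [← hu.dvd_mul_left, ← map_mul, hb, map_mul]
    exact dvd_mul_right _ _
  refine ⟨h.1, fun h0 => h.2.1 (hinj (by rw [h0, map_zero])), fun a ha => ?_⟩
  have h4 : algebraMap S Sq a ∈ IsLocalRing.maximalIdeal Sq :=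
    (IsLocalization.AtPrime.to_map_mem_maximal_iff Sq q a).mpr ha
  rw [← hmax] at h4
  obtain ⟨y, hy⟩ := Ideal.mem_span_singleton.mp (hle h4)
  obtain ⟨b, σ, rfl⟩ := IsLocalization.exists_mk'_eq q.primeCompl y
  refine ⟨σ, σ.2, b, IsLocalization.injective Sq q.primeCompl_le_nonZeroDivisors ?_⟩
  rw [map_mul, hy, IsScalarTower.algebraMap_apply A S Sq, map_mul,
    ← IsLocalization.mk'_spec Sq b σ]
  ring

theorem aux_unram' {A R : Type} [CommRing A] [Algebra ℂ A] [CommRing R] [IsDomain R] [Algebra A R]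
    (T : Set R) (hTf : T.Finite) (Q : Ideal R) [hQ : Q.IsPrime]
    (hroot : ∀ g ∈ T, ∃ (m : ℕ) (c : A), 0 < m ∧ g ^ m = algebraMap A R c ∧ algebraMap A R c ∉ Q)
    (hinj : Function.Injective (algebraMap A R))
    (t : A) (h : AuxUnif (Q.comap (algebraMap A R)) t) :
    AuxUnif (Q.comap (algebraMap (Algebra.adjoin A T) R))
      (algebraMap A (Algebra.adjoin A T) t) := by
  refine aux_unram (A := A) (S := Algebra.adjoin A T) ((↑) ⁻¹' T)
    (hTf.preimage Subtype.val_injective.injOn) ?_ _ ?_ ?_ t ?_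
  · exact Algebra.adjoin_adjoin_coe_preimage
  · intro g hg
    obtain ⟨m, c, hm, h1, h2⟩ := hroot g hg
    exact ⟨m, c, hm, Subtype.ext h1, h2⟩
  · intro a b hab
    exact hinj (congrArg Subtype.val hab)
  · exact h

theorem aux_noeth_adjoin {A R : Type} [CommRing A] [IsNoetherianRing A] [CommRing R] [Algebra A R]
    (T : Set R) (hTf : T.Finite) : IsNoetherianRing (Algebra.adjoin A T) :=
  isNoetherianRing_of_fg ⟨hTf.toFinset, by simp⟩

theorem aux_abhyankar_unit {A R : Type} [CommRing A] [IsNoetherianRing A] [Algebra ℂ A]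
    [CommRing R] [IsDomain R] [Algebra A R] (hinj : Function.Injective (algebraMap A R))
    {ι : Type} [Finite ι] (z : ι → R) (x : ι → A) (m : ι → ℕ) (hm : ∀ i, 0 < m i)
    (hz : ∀ i, z i ^ m i = algebraMap A R (x i))
    (hgen : ∀ r : R, ∃ a : A, a ≠ 0 ∧ algebraMap A R a * r ∈ Algebra.adjoin A (Set.range z))
    (Q : Ideal R) [hQ : Q.IsPrime] (t : A) (h : AuxUnif (Q.comap (algebraMap A R)) t)
    (hx : ∀ j, algebraMap A R (x j) ∉ Q) : AuxUnif Q (algebraMap A R t) := by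
  have h1 := aux_unram' (A := A) (Set.range z) (Set.finite_range z) Q (by
    rintro _ ⟨i, rfl⟩
    exact ⟨m i, x i, hm i, hz i, hx i⟩) hinj t h
  have := aux_noeth_adjoin (A := A) (Set.range z) (Set.finite_range z)
  refine AuxUnif.transfer (S := Algebra.adjoin A (Set.range z)) Subtype.val_injective ?_ Q _ h1
  intro r
  obtain ⟨a, ha, h2⟩ := hgen r
  exact ⟨algebraMap A _ a, fun h0 => ha (hinj ((congrArg Subtype.val h0).trans (map_zero _).symm)),
    ⟨_, h2⟩, rfl⟩

theorem aux_abhyankar {A R : Type} [CommRing A] [IsNoetherianRing A] [Algebra ℂ A]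
    [CommRing R] [IsDomain R] [Algebra A R] (hinj : Function.Injective (algebraMap A R))
    {ι : Type} [Finite ι] (z : ι → R) (x : ι → A) (m : ι → ℕ) (hm : ∀ i, 0 < m i)
    (hz : ∀ i, z i ^ m i = algebraMap A R (x i))
    (hgen : ∀ r : R, ∃ a : A, a ≠ 0 ∧ algebraMap A R a * r ∈ Algebra.adjoin A (Set.range z))
    (Q : Ideal R) [hQ : Q.IsPrime] (t : A) (h : AuxUnif (Q.comap (algebraMap A R)) t)
    (i : ι) (hx : ∀ j, j ≠ i → algebraMap A R (x j) ∉ Q) (hxi : algebraMap A R (x i) ∈ Q)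
    (hxi0 : x i ≠ 0) (u : R) (e : ℕ) (he : 0 < e) (c : A) (hu : u ^ e = algebraMap A R c)
    (hc : algebraMap A R c ∉ Q) (k : ℕ) (hk : 0 < k) (s : A)
    (hut : algebraMap A R t * u = algebraMap A R s * z i ^ k) : AuxUnif Q (z i) := by
  let T1 : Set R := insert u (z '' {j | j ≠ i})
  have hT1 : T1.Finite := (Set.toFinite _).insert _
  let T : Set R := insert (z i) T1
  have hT : T.Finite := hT1.insert _
  let S := Algebra.adjoin A T
  have hzS : z i ∈ S := Algebra.subset_adjoin (Set.mem_insert _ _)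
  have hle1 : Algebra.adjoin A T1 ≤ S := Algebra.adjoin_mono (Set.subset_insert _ _)
  have huS : u ∈ S := hle1 (Algebra.subset_adjoin (Set.mem_insert _ _))
  have h1 := aux_unram' (A := A) T1 hT1 Q (by
    rintro g (rfl | ⟨j, hj, rfl⟩)
    · exact ⟨e, c, he, hu, hc⟩
    · exact ⟨m j, x j, hm j, hz j, hx j hj⟩) hinj t h
  have hdec : ∀ a ∈ S, ∃ a1 ∈ Algebra.adjoin A T1, ∃ a2 ∈ S, a = a1 + z i * a2 := by
    intro a ha
    induction ha using Algebra.adjoin_induction with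
    | mem a ha =>
      rcases ha with rfl | ha
      · exact ⟨0, zero_mem _, 1, one_mem _, by ring⟩
      · exact ⟨a, Algebra.subset_adjoin ha, 0, zero_mem _, by ring⟩
    | algebraMap r => exact ⟨_, algebraMap_mem _ r, 0, zero_mem _, by ring⟩
    | add a b _ _ ha hb =>
      obtain ⟨a1, h1, a2, h2, rfl⟩ := ha
      obtain ⟨b1, h3, b2, h4, rfl⟩ := hb
      exact ⟨a1 + b1, add_mem h1 h3, a2 + b2, add_mem h2 h4, by ring⟩
    | mul a b _ hbS ha hb =>
      obtain ⟨a1, h1, a2, h2, rfl⟩ := ha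
      obtain ⟨b1, h3, b2, h4, rfl⟩ := hb
      exact ⟨a1 * b1, mul_mem h1 h3, a1 * b2 + a2 * (b1 + z i * b2),
        add_mem (mul_mem (hle1 h1) h4) (mul_mem h2 hbS), by ring⟩
  have hz0 : z i ≠ 0 := by
    intro h0
    have := hz i
    rw [h0, zero_pow (hm i).ne'] at this
    exact hxi0 (hinj (this.symm.trans (map_zero _).symm))
  have hzQ : z i ∈ Q := hQ.mem_of_pow_mem _ (hz i ▸ hxi)
  have huQ : u ∉ Q := by
    intro h0
    apply hc
    rw [← hu]; exact Q.pow_mem_of_mem h0 _ he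
  have hS : AuxUnif (Q.comap (algebraMap S R)) (⟨z i, hzS⟩ : S) := by
    refine ⟨hzQ, fun h0 => hz0 (congrArg Subtype.val h0), ?_⟩
    rintro ⟨a, haS⟩ haQ
    change a ∈ Q at haQ
    obtain ⟨a1, ha1, a2, ha2, rfl⟩ := hdec a haS
    have ha1Q : a1 ∈ Q := (Q.add_mem_iff_left (Q.mul_mem_right _ hzQ)).mp haQ
    obtain ⟨σ, hσ, b, hb⟩ := h1.2.2 ⟨a1, ha1⟩ ha1Q
    have hb' : (σ : R) * a1 = algebraMap A R t * b := congrArg Subtype.val hb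
    refine ⟨⟨u * σ, mul_mem huS (hle1 σ.2)⟩, hQ.mul_notMem huQ hσ,
      ⟨algebraMap A R s * z i ^ (k - 1) * b + u * σ * a2, ?_⟩, Subtype.ext ?_⟩
    · exact add_mem (mul_mem (mul_mem (algebraMap_mem _ _) (pow_mem hzS _)) (hle1 b.2))
        (mul_mem (mul_mem huS (hle1 σ.2)) ha2)
    · change u * σ * (a1 + z i * a2) = z i * (algebraMap A R s * z i ^ (k - 1) * b + u * σ * a2)
      obtain ⟨k, rfl⟩ := Nat.exists_eq_succ_of_ne_zero hk.ne'
      rw [Nat.succ_sub_one]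
      rw [Nat.succ_eq_add_one, pow_succ] at hut
      linear_combination u * hb' + b * hut
  have := aux_noeth_adjoin (A := A) T hT
  refine AuxUnif.transfer (S := S) Subtype.val_injective ?_ Q (⟨z i, hzS⟩ : S) hS
  intro r
  obtain ⟨a, ha, h2⟩ := hgen r
  refine ⟨algebraMap A _ a, fun h0 => ha (hinj ((congrArg Subtype.val h0).trans (map_zero _).symm)),
    ⟨_, Algebra.adjoin_mono ?_ h2⟩, rfl⟩
  rintro _ ⟨j, rfl⟩
  by_cases hj : j = i
  · subst hj; exact Set.mem_insert _ _
  · exact Set.mem_insert_of_mem _ (Set.mem_insert_of_mem _ ⟨j, hj, rfl⟩)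

theorem aux_inj_of_flat {P B : Type} [CommRing P] [IsDomain P] [CommRing B] [IsDomain B]
    [Algebra P B] [Module.Flat P B] : Function.Injective (algebraMap P B) := by
  rw [injective_iff_map_eq_zero]
  intro a ha
  by_contra h0
  have := Module.Flat.isSMulRegular_of_nonZeroDivisors (M := B) (mem_nonZeroDivisors_of_ne_zero h0)
  have h1 : a • (1 : B) = a • (0 : B) := by rw [Algebra.smul_def, ha, zero_mul, smul_zero]
  exact one_ne_zero (this h1)

theorem aux_finite_frac {P B K F : Type} [CommRing P] [IsDomain P] [CommRing B] [IsDomain B]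
    [Algebra P B] [Algebra.Etale P B] [Field K] [Algebra P K] [IsFractionRing P K]
    [Field F] [Algebra B F] [IsFractionRing B F] [Algebra P F] [IsScalarTower P B F]
    [Algebra K F] [IsScalarTower P K F] : Module.Finite K F := by
  have h1 : Algebra.FormallyUnramified B F := .of_isLocalization (nonZeroDivisors B)
  have h2 : Algebra.FormallyUnramified P F := .comp P B F
  have h3 : Algebra.FormallyUnramified K F := .of_restrictScalars P K F
  have h4 : Algebra.EssFiniteType B F := .of_isLocalization F (nonZeroDivisors B)
  have h5 : Algebra.EssFiniteType P F := .comp P B F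
  have h6 : Algebra.EssFiniteType K F := .of_comp P K F
  exact Algebra.FormallyUnramified.finite_of_free K F

theorem aux_algebraic {P B : Type} [CommRing P] [IsDomain P] [CommRing B] [IsDomain B]
    [Algebra P B] [Algebra.Etale P B] : Algebra.IsAlgebraic P B := by
  have hinj : Function.Injective (algebraMap P B) := aux_inj_of_flat
  have : FaithfulSMul P B := (faithfulSMul_iff_algebraMap_injective P B).mpr hinj
  have : FaithfulSMul P (FractionRing B) := .trans P B (FractionRing B)
  let := FractionRing.liftAlgebra P (FractionRing B)
  have := FractionRing.isScalarTower_liftAlgebra P (FractionRing B)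
  have := aux_finite_frac (P := P) (B := B) (K := FractionRing P) (F := FractionRing B)
  have h : Algebra.IsAlgebraic P (FractionRing B) :=
    (IsFractionRing.comap_isAlgebraic_iff (A := P) (K := FractionRing P)).mpr inferInstance
  exact h.tower_bot_of_injective (IsFractionRing.injective B (FractionRing B))

open TensorProduct in
theorem aux_normal {P B : Type} [CommRing P] [IsDomain P] [IsIntegrallyClosed P]
    [CommRing B] [IsDomain B] [Algebra P B] [Algebra.Etale P B] : IsIntegrallyClosed B := by
  have hinj : Function.Injective (algebraMap P B) := aux_inj_of_flat
  have halg : Algebra.IsAlgebraic P B := aux_algebraic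
  let K := FractionRing P
  have hloc : IsLocalization (Algebra.algebraMapSubmonoid B (nonZeroDivisors P)) (B ⊗[P] K) :=
    inferInstance
  have : IsFractionRing B (B ⊗[P] K) := by
    refine IsLocalization.isLocalization_of_is_exists_mul_mem _
      (Algebra.algebraMapSubmonoid B (nonZeroDivisors P)) (nonZeroDivisors B) ?_ ?_
    · rintro _ ⟨a, ha, rfl⟩
      refine mem_nonZeroDivisors_of_ne_zero fun h0 => nonZeroDivisors.ne_zero ha ?_
      exact hinj (h0.trans (map_zero _).symm)
    · rintro ⟨x, hx⟩
      obtain ⟨b, a, ha, h⟩ := (Algebra.IsAlgebraic.isAlgebraic (R := P) x).exists_smul_eq_mul 1 hx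
      refine ⟨b, a, mem_nonZeroDivisors_of_ne_zero ha, ?_⟩
      rw [← Algebra.algebraMap_eq_smul_one] at h
      rw [h, mul_comm]
  rw [isIntegrallyClosed_iff (B ⊗[P] K)]
  intro x hx
  obtain ⟨y, hy⟩ := (TensorProduct.toIntegralClosure_bijective_of_smooth
    (R := P) (S := B) (B := K)).2 ⟨x, hx⟩
  have hy' : Algebra.TensorProduct.map (.id _ _) (integralClosure P K).val y = x :=
    congrArg Subtype.val hy
  rw [← hy']
  clear hy hy'
  induction y with
  | zero => exact ⟨0, by simp⟩
  | add a b ha hb =>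
    obtain ⟨a', ha⟩ := ha
    obtain ⟨b', hb⟩ := hb
    exact ⟨a' + b', by rw [map_add, map_add, ha, hb]⟩
  | tmul b c =>
    obtain ⟨c, hc⟩ := c
    obtain ⟨c', rfl⟩ := (isIntegrallyClosed_iff K).mp inferInstance hc
    refine ⟨c' • b, ?_⟩
    rw [Algebra.TensorProduct.algebraMap_apply, Algebra.TensorProduct.map_tmul]
    simp [TensorProduct.smul_tmul, Algebra.algebraMap_eq_smul_one]

theorem aux_at_most_one {n : ℕ} {B A : Type} [CommRing B] [IsDomain B]
    [Algebra (MvPolynomial (Fin n) ℂ) B] [Algebra.Etale (MvPolynomial (Fin n) ℂ) B]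
    [CommRing A] [IsDomain A] [IsNoetherianRing A] [Algebra B A]
    [Algebra (MvPolynomial (Fin n) ℂ) A] [IsScalarTower (MvPolynomial (Fin n) ℂ) B A]
    [Module.Finite B A] (hinj : Function.Injective (algebraMap B A))
    (p : Ideal A) [hp : p.IsPrime] (t : A) (h : AuxUnif p t) (i j : Fin n) (hij : i ≠ j)
    (hi : algebraMap (MvPolynomial (Fin n) ℂ) A (MvPolynomial.X i) ∈ p) :
    algebraMap (MvPolynomial (Fin n) ℂ) A (MvPolynomial.X j) ∉ p := by
  intro hj
  let P := MvPolynomial (Fin n) ℂ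
  have : IsIntegrallyClosed B := aux_normal (P := P)
  have : FaithfulSMul B A := (faithfulSMul_iff_algebraMap_injective B A).mpr hinj
  have : Algebra.HasGoingDown P A := .trans P B A
  have hprime : (Ideal.span {(MvPolynomial.X i : P)}).IsPrime :=
    (Ideal.span_singleton_prime (MvPolynomial.X_ne_zero i)).mpr MvPolynomial.X_prime
  have hle : Ideal.span {(MvPolynomial.X i : P)} ≤ p.under P := by
    rw [Ideal.span_singleton_le_iff_mem]; exact hi
  obtain ⟨p', hp', hprime', hover⟩ := Ideal.exists_ideal_le_liesOver_of_le (q := p.under P) p hle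
  have hi' : algebraMap P A (MvPolynomial.X i) ∈ p' := by
    have : (MvPolynomial.X i : P) ∈ p'.under P := by
      rw [← hover.over]; exact Ideal.mem_span_singleton_self _
    exact this
  have hinj' : Function.Injective (algebraMap P A) := by
    rw [IsScalarTower.algebraMap_eq P B A]
    exact hinj.comp (aux_inj_of_flat (P := P) (B := B))
  have heq := h.eq_of_le p' hp' _ hi' (fun h0 => MvPolynomial.X_ne_zero (R := ℂ) i
    (hinj' (h0.trans (map_zero _).symm)))
  have hj' : (MvPolynomial.X j : P) ∈ Ideal.span {(MvPolynomial.X i : P)} := by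
    rw [hover.over, heq]; exact hj
  rw [Ideal.mem_span_singleton, MvPolynomial.X_dvd_X] at hj'
  exact hij hj'

theorem aux_smooth_lift {P S E : Type} [CommRing P] [CommRing S] [CommRing E] [Algebra P S]
    [Algebra.FormallySmooth P S] (φ : P →+* E) (π : E →+* S)
    (hφ : ∀ r, π (φ r) = algebraMap P S r)
    (hsurj : Function.Surjective π) (hker : ∀ a b, π a = 0 → π b = 0 → a * b = 0) :
    ∃ g : S →+* E, (∀ s, π (g s) = s) ∧ ∀ r, g (algebraMap P S r) = φ r := by
  let := φ.toAlgebra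
  let π' : E →ₐ[P] S := { π with commutes' := hφ }
  have hn : IsNilpotent (RingHom.ker (π' : E →+* S)) := by
    refine ⟨2, ?_⟩
    rw [pow_two, Ideal.zero_eq_bot, eq_bot_iff, Ideal.mul_le]
    intro a ha b hb
    exact hker a b ha hb
  refine ⟨Algebra.FormallySmooth.liftOfSurjective (AlgHom.id P S) π' hsurj hn, ?_, ?_⟩
  · intro s
    exact Algebra.FormallySmooth.liftOfSurjective_apply (AlgHom.id P S) π' hsurj hn s
  · intro r
    exact (Algebra.FormallySmooth.liftOfSurjective (AlgHom.id P S) π' hsurj hn).commutes r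

theorem aux_formallySmooth_deriv {n : ℕ} {S : Type} [CommRing S] [Algebra ℂ S]
    [Algebra (MvPolynomial (Fin n) ℂ) S] [IsScalarTower ℂ (MvPolynomial (Fin n) ℂ) S]
    [Algebra.FormallySmooth (MvPolynomial (Fin n) ℂ) S] (v : Fin n → S) :
    ∃ D : Derivation ℂ S S,
      ∀ k, D (algebraMap (MvPolynomial (Fin n) ℂ) S (MvPolynomial.X k)) = v k := by
  let P := MvPolynomial (Fin n) ℂ
  let φ : P →ₐ[ℂ] TrivSqZeroExt S S := MvPolynomial.aeval
    (fun k => TrivSqZeroExt.inl (algebraMap P S (MvPolynomial.X k)) + TrivSqZeroExt.inr (v k))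
  have hφ : ∀ r : P, TrivSqZeroExt.fst (φ r) = algebraMap P S r := by
    intro r
    have : (TrivSqZeroExt.fstHom ℂ S S).comp φ = IsScalarTower.toAlgHom ℂ P S := by
      apply MvPolynomial.algHom_ext
      intro k
      simp [-DualNumber.inr_eq_smul_eps, φ, P]
    exact DFunLike.congr_fun this r
  obtain ⟨g, hg1, hg2⟩ := aux_smooth_lift (S := S) φ.toRingHom
    (TrivSqZeroExt.fstHom ℂ S S).toRingHom hφ
    (fun s => ⟨TrivSqZeroExt.inl s, rfl⟩) (by
      intro a b ha hb
      change TrivSqZeroExt.fst a = 0 at ha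
      change TrivSqZeroExt.fst b = 0 at hb
      ext <;> simp [ha, hb])
  have hg1' : ∀ s, TrivSqZeroExt.fst (g s) = s := hg1
  have hgc : ∀ c : ℂ, g (algebraMap ℂ S c) = algebraMap ℂ (TrivSqZeroExt S S) c := by
    intro c
    rw [IsScalarTower.algebraMap_apply ℂ P S, hg2]
    exact φ.commutes c
  refine ⟨Derivation.mk'
    { toFun := fun s => TrivSqZeroExt.snd (g s)
      map_add' := fun a b => by simp
      map_smul' := fun c a => by
        rw [Algebra.smul_def, map_mul, hgc, ← Algebra.smul_def]
        simp } ?_, ?_⟩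
  · intro a b
    simp [hg1', TrivSqZeroExt.snd_mul, mul_comm]
  · intro k
    change TrivSqZeroExt.snd (g _) = _
    rw [hg2]
    change TrivSqZeroExt.snd (φ (MvPolynomial.X k)) = _
    have : φ (MvPolynomial.X k) = _ := MvPolynomial.aeval_X _ k
    rw [this]; simp [-DualNumber.inr_eq_smul_eps]

theorem aux_deriv_unique {n : ℕ} {S M : Type} [CommRing S] [Algebra ℂ S]
    [Algebra (MvPolynomial (Fin n) ℂ) S] [IsScalarTower ℂ (MvPolynomial (Fin n) ℂ) S]
    [Algebra.FormallyUnramified (MvPolynomial (Fin n) ℂ) S] [AddCommGroup M] [Module S M]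
    [Module ℂ M] [IsScalarTower ℂ S M]
    (D D' : Derivation ℂ S M)
    (h : ∀ k, D (algebraMap (MvPolynomial (Fin n) ℂ) S (MvPolynomial.X k)) =
      D' (algebraMap (MvPolynomial (Fin n) ℂ) S (MvPolynomial.X k))) : D = D' := by
  let P := MvPolynomial (Fin n) ℂ
  let : Module P M := Module.compHom M (algebraMap P S)
  have : IsScalarTower P S M := ⟨fun a b c => by
    rw [Algebra.smul_def, mul_smul]; rfl⟩
  have h0 : ∀ r : P, (D - D') (algebraMap P S r) = 0 := by
    intro r
    induction r using MvPolynomial.induction_on with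
    | C c =>
      have : algebraMap P S (MvPolynomial.C c) = algebraMap ℂ S c :=
        (IsScalarTower.algebraMap_apply ℂ P S c).symm
      rw [this, Derivation.map_algebraMap]
    | add a b ha hb => rw [map_add, map_add, ha, hb, add_zero]
    | mul_X a k ha =>
      have hk : (D - D') (algebraMap P S (MvPolynomial.X k)) = 0 := by
        rw [Derivation.sub_apply, h k, sub_self]
      rw [map_mul, Derivation.leibniz, ha, hk, smul_zero, smul_zero, add_zero]
  let D1 : Derivation P S M := Derivation.mk'
    { toFun := fun s => (D - D') s
      map_add' := fun a b => map_add _ a b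
      map_smul' := fun r a => by
        rw [Algebra.smul_def, Derivation.leibniz, h0, smul_zero, add_zero]; rfl }
    (fun a b => (D - D').leibniz a b)
  have h1 : D1 = 0 := by
    have := (Derivation.liftKaehlerDifferential_comp D1).symm
    rw [this]
    ext s
    have : KaehlerDifferential.D P S s = 0 := Subsingleton.elim _ _
    simp [this]
  ext s
  have := DFunLike.congr_fun h1 s
  change (D - D') s = 0 at this
  rwa [Derivation.sub_apply, sub_eq_zero] at this

theorem aux_field {L : Type} [Field L] [Algebra ℂ L] {n : ℕ} (s : Finset (Fin n)) (x : Fin n → L)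
    (hx : ∀ i, x i ≠ 0) (d : ℕ) (hd : 0 < d) :
    ∃ (L' : Type) (_ : Field L') (_ : Algebra L L'), FiniteDimensional L L' ∧ IsGalois L L' ∧
      ∃ z : Fin n → L', (∀ i ∈ s, z i ^ d = algebraMap L L' (x i)) ∧
        (∀ i, i ∉ s → z i = algebraMap L L' (x i)) ∧
        Algebra.adjoin L (Set.range (fun i : s => z i)) = ⊤ := by
  classical
  let q : Polynomial L := ∏ i ∈ s, (Polynomial.X ^ d - Polynomial.C (x i))
  let L' := q.SplittingField
  have hCZ : CharZero L := charZero_of_injective_algebraMap (algebraMap ℂ L).injective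
  have hnorm : Normal L L' := Normal.of_isSplittingField q
  have hgal : IsGalois L L' := IsGalois.mk
  have hq0 : q ≠ 0 := Finset.prod_ne_zero_iff.mpr fun i _ => Polynomial.X_pow_sub_C_ne_zero hd _
  have hroot : ∀ i ∈ s, ∃ z : L', z ^ d = algebraMap L L' (x i) := by
    intro i hi
    have hs : (Polynomial.map (algebraMap L L') q).Splits := Polynomial.SplittingField.splits q
    have hdvd : (Polynomial.X ^ d - Polynomial.C (x i)) ∣ q := Finset.dvd_prod_of_mem _ hi
    have h1 : (Polynomial.map (algebraMap L L') (Polynomial.X ^ d - Polynomial.C (x i))).Splits :=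
      hs.of_dvd (Polynomial.map_ne_zero hq0) (Polynomial.map_dvd _ hdvd)
    obtain ⟨z, hz⟩ := h1.exists_eval_eq_zero (by
      rw [Polynomial.degree_map, Polynomial.degree_X_pow_sub_C hd]
      exact_mod_cast hd.ne')
    refine ⟨z, ?_⟩
    simpa [sub_eq_zero] using hz
  choose! z hz using hroot
  refine ⟨L', inferInstance, inferInstance, inferInstance, hgal,
    fun i => if i ∈ s then z i else algebraMap L L' (x i), ?_, ?_, ?_⟩
  · intro i hi
    simp only [hi, if_true]
    exact hz i hi
  · intro i hi
    simp only [hi, if_false]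
  · rw [eq_top_iff, ← Polynomial.SplittingField.adjoin_rootSet q]
    refine Algebra.adjoin_le ?_
    intro r hr
    rw [Polynomial.mem_rootSet] at hr
    have h2 := hr.2
    simp only [q, map_prod, Finset.prod_eq_zero_iff] at h2
    obtain ⟨i, hi, h3⟩ := h2
    have h4 : r ^ d = algebraMap L L' (x i) := by
      simpa [sub_eq_zero] using h3
    have hzi : z i ≠ 0 := by
      intro h0
      have := hz i hi
      rw [h0, zero_pow hd.ne', eq_comm, map_eq_zero] at this
      exact hx i this
    have h5 : (r / z i) ^ d = 1 := by
      rw [div_pow, h4, hz i hi, div_self]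
      rw [Ne, map_eq_zero]; exact hx i
    have hζ := Complex.isPrimitiveRoot_exp d hd.ne'
    have hζ' := hζ.map_of_injective (f := (algebraMap L L').comp (algebraMap ℂ L))
      ((algebraMap L L').comp (algebraMap ℂ L)).injective
    have : NeZero d := ⟨hd.ne'⟩
    obtain ⟨m, -, hm⟩ := hζ'.eq_pow_of_pow_eq_one h5
    have h6 : r = algebraMap L L' (algebraMap ℂ L (Complex.exp (2 * Real.pi * Complex.I / d)) ^ m)
        * z i := by
      rw [map_pow]
      rw [RingHom.comp_apply] at hm
      rw [hm, div_mul_cancel₀ _ hzi]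
    rw [h6]
    refine Subalgebra.mul_mem _ (Subalgebra.algebraMap_mem _ _)
      (Algebra.subset_adjoin ⟨⟨i, hi⟩, ?_⟩)
    simp [hi]

theorem aux_choose_d {A : Type} [CommRing A] [IsDomain A] [IsNoetherianRing A] {n : ℕ}
    (x : Fin n → A) (hx : ∀ i, x i ≠ 0) :
    ∃ d : ℕ, 0 < d ∧ ∀ (i : Fin n) (p : Ideal A) (_ : p.IsPrime), (∃ t, AuxUnif p t) → x i ∈ p →
      ∃ (t : A) (e : ℕ) (a b : A), AuxUnif p t ∧ 0 < e ∧ e ∣ d ∧ a ∉ p ∧ b ∉ p ∧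
        a * x i = b * t ^ e := by
  classical
  have h1 : ∀ (i : Fin n) (p : Ideal A), ∃ e : ℕ, 0 < e ∧
      (p.IsPrime → (∃ t, AuxUnif p t) → x i ∈ p → ∃ (t a b : A), AuxUnif p t ∧ a ∉ p ∧ b ∉ p ∧
        a * x i = b * t ^ e) := by
    intro i p
    by_cases h : p.IsPrime ∧ (∃ t, AuxUnif p t) ∧ x i ∈ p
    · obtain ⟨hp, ⟨t, ht⟩, hxp⟩ := h
      obtain ⟨e, a, b, ha, hb, hab⟩ := ht.exists_pow (x i) (hx i)
      refine ⟨e, Nat.pos_of_ne_zero ?_, fun _ _ _ => ⟨t, a, b, ht, ha, hb, hab⟩⟩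
      rintro rfl
      rw [pow_zero, mul_one] at hab
      exact hb (hab ▸ p.mul_mem_left _ hxp)
    · exact ⟨1, one_pos, fun h1 h2 h3 => absurd ⟨h1, h2, h3⟩ h⟩
  choose e he0 he using h1
  have hfin : ∀ i, (Ideal.span {x i}).minimalPrimes.Finite := fun i =>
    Ideal.finite_minimalPrimes_of_isNoetherianRing A _
  refine ⟨∏ i, ∏ p ∈ (hfin i).toFinset, e i p,
    Finset.prod_pos fun i _ => Finset.prod_pos fun p _ => he0 i p, ?_⟩
  intro i p hp ht hxp
  obtain ⟨t, a, b, h1, h2, h3, h4⟩ := he i p hp ht hxp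
  refine ⟨t, e i p, a, b, h1, he0 i p, ?_, h2, h3, h4⟩
  refine dvd_trans ?_ (Finset.dvd_prod_of_mem _ (Finset.mem_univ i))
  refine Finset.dvd_prod_of_mem _ ?_
  rw [Set.Finite.mem_toFinset]
  exact h1.mem_minimalPrimes _ hxp (hx i)

theorem aux_star {n : ℕ} {B A L L' R : Type} [CommRing B] [IsDomain B] [Algebra ℂ B]
    [Algebra (MvPolynomial (Fin n) ℂ) B] [Algebra.Etale (MvPolynomial (Fin n) ℂ) B]
    [CommRing A] [IsDomain A] [IsNoetherianRing A] [IsIntegrallyClosed A] [Algebra ℂ A]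
    [Algebra B A]
    [Algebra (MvPolynomial (Fin n) ℂ) A] [IsScalarTower (MvPolynomial (Fin n) ℂ) B A]
    [Module.Finite B A] (hinj : Function.Injective (algebraMap B A))
    [Field L] [Algebra A L] [IsFractionRing A L]
    [Field L'] [Algebra L L'] [Algebra A L'] [IsScalarTower A L L'] [FiniteDimensional L L']
    [CommRing R] [IsDomain R] [IsNoetherianRing R] [Algebra A R] [Algebra R L']
    [IsScalarTower A R L'] [IsIntegralClosure R A L'] [IsFractionRing R L']
    [Algebra B R] [IsScalarTower B A R] [Module.Finite B R] [Algebra ℂ L']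
    (s : Finset (Fin n)) (x : Fin n → A)
    (hx : ∀ i, x i = algebraMap (MvPolynomial (Fin n) ℂ) A (MvPolynomial.X i))
    (hx0 : ∀ i, x i ≠ 0)
    (d : ℕ) (hd : 0 < d) (hdd : ∀ (i : Fin n) (p : Ideal A) (_ : p.IsPrime),
      (∃ t, AuxUnif p t) → x i ∈ p →
      ∃ (t : A) (e : ℕ) (a b : A), AuxUnif p t ∧ 0 < e ∧ e ∣ d ∧ a ∉ p ∧ b ∉ p ∧
        a * x i = b * t ^ e)
    (z : Fin n → R) (hz : ∀ i ∈ s, z i ^ d = algebraMap A R (x i))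
    (hgen : ∀ r : R, ∃ a : A, a ≠ 0 ∧
      algebraMap A R a * r ∈ Algebra.adjoin A (Set.range fun i : s => z i))
    (D : Derivation ℂ L' L') (hDz : ∀ i, ∃ r, D (algebraMap R L' (z i)) = algebraMap R L' r)
    (hDB : ∀ b : B, ∃ r, D (algebraMap R L' (algebraMap B R b)) = algebraMap R L' r)
    (hDA : ∀ a : A, ∃ (N : ℕ) (r : R), algebraMap A L' ((∏ i ∈ s, x i) ^ N) *
      D (algebraMap A L' a) = algebraMap R L' r) (r : R) :
    ∃ r', algebraMap R L' r' = D (algebraMap R L' r) := by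
  have hinjAL' : Function.Injective (algebraMap A L') := by
    rw [IsScalarTower.algebraMap_eq A L L']
    exact (algebraMap L L').injective.comp (IsFractionRing.injective A L)
  have hinjAR : Function.Injective (algebraMap A R) := by
    have := hinjAL'
    rw [IsScalarTower.algebraMap_eq A R L'] at this
    exact Function.Injective.of_comp this
  refine aux_descend (A := A) (L := L) (L' := L') (R := R) _ ?_
  intro p hp t ht Q hQ hQp
  subst hQp
  have hloc : ∀ {y : L'}, (∃ r, y = algebraMap R L' r) → y ∈ auxLoc Q L' := by
    rintro _ ⟨r, rfl⟩
    exact auxLoc_algebraMap_mem Q L' r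
  by_cases hex : ∃ i ∈ s, x i ∈ Q.comap (algebraMap A R)
  · obtain ⟨i, hi, hxi⟩ := hex
    obtain ⟨t, e, a, b, ht, he, ⟨k, hk⟩, ha, hb, hab⟩ := hdd i _ hp ⟨t, ht⟩ hxi
    have hk0 : 0 < k := by
      rcases Nat.eq_zero_or_pos k with h | h
      · simp [h] at hk; omega
      · exact h
    have ht0 : algebraMap A L' t ≠ 0 := fun h0 => ht.2.1 (hinjAL' (h0.trans (map_zero _).symm))
    let u' : L' := algebraMap A L' a * algebraMap R L' (z i) ^ k / algebraMap A L' t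
    obtain ⟨e, rfl⟩ := Nat.exists_eq_succ_of_ne_zero he.ne'
    have hzL : algebraMap R L' (z i) ^ d = algebraMap A L' (x i) := by
      rw [← map_pow, hz i hi, ← IsScalarTower.algebraMap_apply]
    have hu' : u' ^ (e + 1) = algebraMap A L' (a ^ e * b) := by
      rw [div_pow, div_eq_iff (pow_ne_zero _ ht0), mul_pow, ← pow_mul, mul_comm k,
        ← Nat.succ_eq_add_one, ← hk, hzL, pow_succ, mul_assoc, ← map_mul, hab]
      simp only [map_mul, map_pow]
      ring
    have hint : IsIntegral A u' := by
      refine IsIntegral.of_pow (Nat.succ_pos e) ?_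
      rw [hu']
      exact isIntegral_algebraMap
    obtain ⟨u, hu⟩ := IsIntegralClosure.isIntegral_iff (A := R).mp hint
    have hinjR := IsFractionRing.injective R L'
    have hQz : AuxUnif Q (z i) := by
      refine aux_abhyankar hinjAR (fun i : s => z i) (fun i : s => x i) (fun _ => d)
        (fun _ => hd) (fun i => hz i i.2) hgen Q t ht ⟨i, hi⟩ ?_ hxi (hx0 i) u (e + 1)
        (Nat.succ_pos e) (a ^ e * b) ?_ ?_ k hk0 a ?_
      · rintro ⟨j, hj⟩ hji
        have hij : i ≠ j := fun h => hji (Subtype.ext h.symm)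
        have := aux_at_most_one hinj _ t ht i j hij (by rw [← hx]; exact hxi)
        rw [← hx] at this
        exact this
      · apply hinjR
        rw [map_pow, hu, hu', ← IsScalarTower.algebraMap_apply]
      · rw [map_mul, map_pow]
        exact hQ.mul_notMem (fun h => ha (hQ.mem_of_pow_mem _ h)) hb
      · apply hinjR
        rw [map_mul, map_mul, map_pow, hu, ← IsScalarTower.algebraMap_apply,
          ← IsScalarTower.algebraMap_apply, mul_div_cancel₀ _ ht0]
    exact aux_deriv_local (B := B) D Q (z i) hQz (hloc (hDz i)) (fun b => hloc (hDB b)) r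
  · push Not at hex
    have hQt : AuxUnif Q (algebraMap A R t) :=
      aux_abhyankar_unit hinjAR (fun i : s => z i) (fun i : s => x i) (fun _ => d)
        (fun _ => hd) (fun i => hz i i.2) hgen Q t ht (fun j => hex j j.2)
    refine aux_deriv_local (B := B) D Q _ hQt ?_ (fun b => hloc (hDB b)) r
    obtain ⟨N, r, hr⟩ := hDA t
    rw [← IsScalarTower.algebraMap_apply]
    refine auxLoc_mem_of_mul_mem Q L' (algebraMap A R ((∏ i ∈ s, x i) ^ N)) ?_ _ ?_
    · rw [map_pow]
      intro h
      have h1 := hQ.mem_of_pow_mem _ h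
      rw [map_prod, hQ.prod_mem_iff] at h1
      obtain ⟨i, hi, h2⟩ := h1
      exact hex i hi h2
    · rw [← IsScalarTower.algebraMap_apply, hr]
      exact auxLoc_algebraMap_mem Q L' r

theorem aux_deriv_alg {n : ℕ} {S M : Type} [CommRing S] [IsDomain S] [Algebra ℂ S]
    [Algebra (MvPolynomial (Fin n) ℂ) S] [IsScalarTower ℂ (MvPolynomial (Fin n) ℂ) S]
    [Algebra.IsAlgebraic (MvPolynomial (Fin n) ℂ) S] [AddCommGroup M] [Module S M]
    [Module ℂ M] [IsScalarTower ℂ S M]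
    (hinj : Function.Injective (algebraMap (MvPolynomial (Fin n) ℂ) S))
    (htf : ∀ (s : S) (m : M), s ≠ 0 → s • m = 0 → m = 0)
    (D D' : Derivation ℂ S M)
    (h : ∀ k, D (algebraMap (MvPolynomial (Fin n) ℂ) S (MvPolynomial.X k)) =
      D' (algebraMap (MvPolynomial (Fin n) ℂ) S (MvPolynomial.X k))) : D = D' := by
  let P := MvPolynomial (Fin n) ℂ
  let : Module P M := Module.compHom M (algebraMap P S)
  have : IsScalarTower P S M := ⟨fun a b c => by
    rw [Algebra.smul_def, mul_smul]; rfl⟩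
  have h0 : ∀ r : P, (D - D') (algebraMap P S r) = 0 := by
    intro r
    induction r using MvPolynomial.induction_on with
    | C c =>
      have : algebraMap P S (MvPolynomial.C c) = algebraMap ℂ S c :=
        (IsScalarTower.algebraMap_apply ℂ P S c).symm
      rw [this, Derivation.map_algebraMap]
    | add a b ha hb => rw [map_add, map_add, ha, hb, add_zero]
    | mul_X a k ha =>
      have hk : (D - D') (algebraMap P S (MvPolynomial.X k)) = 0 := by
        rw [Derivation.sub_apply, h k, sub_self]
      rw [map_mul, Derivation.leibniz, ha, hk, smul_zero, smul_zero, add_zero]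
  let D1 : Derivation P S M := Derivation.mk'
    { toFun := fun s => (D - D') s
      map_add' := fun a b => map_add _ a b
      map_smul' := fun r a => by
        rw [Algebra.smul_def, Derivation.leibniz, h0, smul_zero, add_zero]; rfl }
    (fun a b => (D - D').leibniz a b)
  have key : ∀ (N : ℕ) (a : S) (q : Polynomial P), q.natDegree ≤ N → q ≠ 0 →
      Polynomial.aeval a q = 0 → D1 a = 0 := by
    intro N
    induction N with
    | zero =>
      intro a q hq h0 ha
      rw [Polynomial.eq_C_of_natDegree_le_zero hq] at ha h0
      rw [Polynomial.aeval_C] at ha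
      exact absurd (hinj (ha.trans (map_zero _).symm)) (by simpa using h0)
    | succ N ih =>
      intro a q hq h0 ha
      have h1 : Polynomial.aeval a (Polynomial.derivative q) • D1 a = 0 := by
        rw [← Derivation.map_aeval, ha, map_zero]
      by_cases h2 : Polynomial.aeval a (Polynomial.derivative q) = 0
      · by_cases h3 : Polynomial.derivative q = 0
        · have := Polynomial.derivative_eq_zero.mp h3
          exact ih a q (by omega) h0 ha
        · exact ih a _ (by have := Polynomial.natDegree_derivative_le q; omega) h3 h2
      · exact htf _ _ h2 h1
  ext s
  obtain ⟨q, hq, hs⟩ := Algebra.IsAlgebraic.isAlgebraic (R := P) s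
  have : (D - D') s = 0 := key _ s q le_rfl hq hs
  rwa [Derivation.sub_apply, sub_eq_zero] at this

theorem aux_deriv_compare {n : ℕ} {S L' : Type} [CommRing S] [IsDomain S] [Algebra ℂ S]
    [Algebra (MvPolynomial (Fin n) ℂ) S] [IsScalarTower ℂ (MvPolynomial (Fin n) ℂ) S]
    [Algebra.IsAlgebraic (MvPolynomial (Fin n) ℂ) S] [Field L'] [Algebra ℂ L'] [Algebra S L']
    [Algebra (MvPolynomial (Fin n) ℂ) L'] [IsScalarTower (MvPolynomial (Fin n) ℂ) S L']
    [IsScalarTower ℂ S L']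
    (hinj : Function.Injective (algebraMap (MvPolynomial (Fin n) ℂ) S))
    (hinj' : Function.Injective (algebraMap S L'))
    (D : Derivation ℂ L' L') (E : Derivation ℂ S S) (c : L')
    (h : ∀ k, D (algebraMap (MvPolynomial (Fin n) ℂ) L' (MvPolynomial.X k)) =
      c * algebraMap S L' (E (algebraMap (MvPolynomial (Fin n) ℂ) S (MvPolynomial.X k)))) (a : S) :
    D (algebraMap S L' a) = c * algebraMap S L' (E a) := by
  let D1 : Derivation ℂ S L' := Derivation.mk'
    { toFun := fun s => D (algebraMap S L' s)
      map_add' := fun a b => by rw [map_add, map_add]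
      map_smul' := fun r a => by
        rw [Algebra.algebraMap_eq_smul_one, smul_assoc, Derivation.map_smul, ← Algebra.algebraMap_eq_smul_one]
        rfl }
    (fun a b => by
      change D _ = _
      rw [map_mul, Derivation.leibniz]
      simp [Algebra.smul_def])
  let D2 : Derivation ℂ S L' := Derivation.mk'
    { toFun := fun s => c * algebraMap S L' (E s)
      map_add' := fun a b => by rw [map_add, map_add, mul_add]
      map_smul' := fun r a => by
        rw [Derivation.map_smul, Algebra.algebraMap_eq_smul_one, smul_assoc, mul_smul_comm,
          ← Algebra.algebraMap_eq_smul_one]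
        rfl }
    (fun a b => by
      change c * _ = _
      rw [Derivation.leibniz]
      simp [Algebra.smul_def]
      ring)
  have : D1 = D2 := by
    refine aux_deriv_alg hinj ?_ D1 D2 ?_
    · intro s m hs hm
      rw [Algebra.smul_def] at hm
      exact (mul_eq_zero.mp hm).resolve_left fun h0 => hs (hinj' (h0.trans (map_zero _).symm))
    · intro k
      change D (algebraMap S L' _) = c * _
      rw [← h, ← IsScalarTower.algebraMap_apply]
  exact DFunLike.congr_fun this a

theorem aux_restrict_deriv {R L' : Type} [CommRing R] [Field L'] [Algebra ℂ L'] [Algebra ℂ R]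
    [Algebra R L'] [IsScalarTower ℂ R L'] (hinj : Function.Injective (algebraMap R L'))
    (D : Derivation ℂ L' L') (h : ∀ r, ∃ r', algebraMap R L' r' = D (algebraMap R L' r)) :
    ∃ E : Derivation ℂ R R, ∀ r, algebraMap R L' (E r) = D (algebraMap R L' r) := by
  choose E hE using h
  refine ⟨Derivation.mk'
    { toFun := E
      map_add' := fun a b => hinj (by rw [map_add, hE, hE, hE, map_add, map_add])
      map_smul' := fun c a => hinj (by
        have h1 : ∀ y, algebraMap R L' (c • y) = c • algebraMap R L' y := fun y => by
          rw [Algebra.algebraMap_eq_smul_one, smul_assoc, ← Algebra.algebraMap_eq_smul_one]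
        rw [hE, h1, Derivation.map_smul, RingHom.id_apply, h1, hE]) }
    (fun a b => hinj (by
      change algebraMap R L' (E _) = _
      rw [hE, map_mul, Derivation.leibniz, ← hE, ← hE]
      simp)), fun r => hE r⟩

theorem aux_formallyEtale_field {P F : Type} [CommRing P] [IsDomain P] [CharZero P] [Field F]
    [Algebra P F] [Algebra.IsAlgebraic P F] (hinj : Function.Injective (algebraMap P F)) :
    Algebra.FormallyEtale P F := by
  let K := FractionRing P
  have : FaithfulSMul P F := (faithfulSMul_iff_algebraMap_injective P F).mpr hinj
  let : Algebra K F := FractionRing.liftAlgebra P F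
  have : IsScalarTower P K F := FractionRing.isScalarTower_liftAlgebra P F
  have : Algebra.IsAlgebraic K F :=
    (IsFractionRing.comap_isAlgebraic_iff (A := P) (K := K)).mp inferInstance
  have : CharZero K := charZero_of_injective_algebraMap (IsFractionRing.injective P K)
  have h1 : Algebra.FormallyEtale P K := .of_isLocalization (nonZeroDivisors P)
  have h2 : Algebra.FormallyEtale K F := .of_isSeparable K F
  exact .comp P K F

theorem aux_core {n : ℕ} {B A S L L' R : Type} [CommRing B] [IsDomain B] [Algebra ℂ B]
    [Algebra (MvPolynomial (Fin n) ℂ) B] [IsScalarTower ℂ (MvPolynomial (Fin n) ℂ) B]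
    [Algebra.Etale (MvPolynomial (Fin n) ℂ) B]
    [CommRing A] [IsDomain A] [IsNoetherianRing A] [IsIntegrallyClosed A] [Algebra ℂ A]
    [Algebra B A]
    [Algebra (MvPolynomial (Fin n) ℂ) A] [IsScalarTower (MvPolynomial (Fin n) ℂ) B A]
    [IsScalarTower ℂ (MvPolynomial (Fin n) ℂ) A]
    [Module.Finite B A] (hinj : Function.Injective (algebraMap B A))
    [CommRing S] [IsDomain S] [Algebra A S] [Algebra ℂ S] [Algebra (MvPolynomial (Fin n) ℂ) S]
    [IsScalarTower (MvPolynomial (Fin n) ℂ) A S] [IsScalarTower ℂ (MvPolynomial (Fin n) ℂ) S]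
    [Algebra.FormallySmooth (MvPolynomial (Fin n) ℂ) S]
    [Field L] [Algebra A L] [IsFractionRing A L]
    [Field L'] [Algebra L L'] [Algebra A L'] [IsScalarTower A L L'] [FiniteDimensional L L']
    [Algebra B L'] [IsScalarTower B A L'] [Algebra (MvPolynomial (Fin n) ℂ) L']
    [IsScalarTower (MvPolynomial (Fin n) ℂ) A L'] [Algebra S L'] [IsScalarTower A S L']
    [CommRing R] [IsDomain R] [IsNoetherianRing R] [Algebra A R] [Algebra R L']
    [IsScalarTower A R L'] [IsIntegralClosure R A L'] [IsFractionRing R L'] [Module.Finite A R]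
    [Algebra B R] [IsScalarTower B A R] [Algebra ℂ L']
    [IsScalarTower ℂ (MvPolynomial (Fin n) ℂ) L'] [Algebra ℂ R] [IsScalarTower ℂ R L']
    (s : Finset (Fin n)) (x : Fin n → A)
    (hx : ∀ i, x i = algebraMap (MvPolynomial (Fin n) ℂ) A (MvPolynomial.X i))
    [IsLocalization.Away (∏ i ∈ s, x i) S]
    (hx0 : ∀ i, x i ≠ 0)
    (d : ℕ) (hd : 0 < d) (hdd : ∀ (i : Fin n) (p : Ideal A) (_ : p.IsPrime),
      (∃ t, AuxUnif p t) → x i ∈ p →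
      ∃ (t : A) (e : ℕ) (a b : A), AuxUnif p t ∧ 0 < e ∧ e ∣ d ∧ a ∉ p ∧ b ∉ p ∧
        a * x i = b * t ^ e)
    (z : Fin n → R) (hz : ∀ i ∈ s, z i ^ d = algebraMap A R (x i))
    (hz' : ∀ i, i ∉ s → z i = algebraMap A R (x i))
    (hgen : ∀ r : R, ∃ a : A, a ≠ 0 ∧
      algebraMap A R a * r ∈ Algebra.adjoin A (Set.range fun i : s => z i)) :
    Algebra.Smooth ℂ R := by
  classical
  let P := MvPolynomial (Fin n) ℂ
  -- towers and injectivity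
  have hinjAL' : Function.Injective (algebraMap A L') := by
    rw [IsScalarTower.algebraMap_eq A L L']
    exact (algebraMap L L').injective.comp (IsFractionRing.injective A L)
  have hinjRL' := IsFractionRing.injective R L'
  have hinjPB : Function.Injective (algebraMap P B) := aux_inj_of_flat
  have hinjPA : Function.Injective (algebraMap P A) := by
    rw [IsScalarTower.algebraMap_eq P B A]; exact hinj.comp hinjPB
  have hinjPL' : Function.Injective (algebraMap P L') := by
    rw [IsScalarTower.algebraMap_eq P A L']; exact hinjAL'.comp hinjPA
  have hinjBL' : Function.Injective (algebraMap B L') := by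
    rw [IsScalarTower.algebraMap_eq B A L']; exact hinjAL'.comp hinj
  have t1 : IsScalarTower P B L' := .of_algebraMap_eq fun r => by
    rw [IsScalarTower.algebraMap_apply P A L', IsScalarTower.algebraMap_apply P B A,
      ← IsScalarTower.algebraMap_apply B A L']
  have t2 : IsScalarTower ℂ B L' := .of_algebraMap_eq fun r => by
    rw [IsScalarTower.algebraMap_apply ℂ P L', IsScalarTower.algebraMap_apply P B L',
      ← IsScalarTower.algebraMap_apply ℂ P B]
  have t3 : IsScalarTower P S L' := .of_algebraMap_eq fun r => by
    rw [IsScalarTower.algebraMap_apply P A L', IsScalarTower.algebraMap_apply P A S,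
      ← IsScalarTower.algebraMap_apply A S L']
  have t4 : IsScalarTower ℂ S L' := .of_algebraMap_eq fun r => by
    rw [IsScalarTower.algebraMap_apply ℂ P L', IsScalarTower.algebraMap_apply P S L',
      ← IsScalarTower.algebraMap_apply ℂ P S]
  have t5 : IsScalarTower B R L' := .of_algebraMap_eq fun r => by
    rw [IsScalarTower.algebraMap_apply B A L', IsScalarTower.algebraMap_apply B A R,
      ← IsScalarTower.algebraMap_apply A R L']
  have t6 : IsScalarTower ℂ A R := .of_algebraMap_eq fun r => hinjRL' (by
    rw [← IsScalarTower.algebraMap_apply ℂ R L', ← IsScalarTower.algebraMap_apply A R L',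
      IsScalarTower.algebraMap_apply ℂ P L', IsScalarTower.algebraMap_apply ℂ P A,
      ← IsScalarTower.algebraMap_apply P A L'])
  have hf0 : (∏ i ∈ s, x i) ≠ 0 := Finset.prod_ne_zero_iff.mpr fun i _ => hx0 i
  have hinjSL' : Function.Injective (algebraMap S L') := by
    rw [injective_iff_map_eq_zero]
    intro y hy
    obtain ⟨⟨a, m⟩, ha⟩ := IsLocalization.surj (Submonoid.powers (∏ i ∈ s, x i)) y
    have h1 : algebraMap A L' a = 0 := by
      rw [IsScalarTower.algebraMap_apply A S L', ← ha, map_mul, hy, zero_mul]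
    have h2 : a = 0 := hinjAL' (h1.trans (map_zero _).symm)
    simp only [h2, map_zero] at ha
    exact (IsUnit.mul_left_eq_zero (IsLocalization.map_units S m)).mp ha
  have hinjPS : Function.Injective (algebraMap P S) := by
    have := hinjPL'
    rw [IsScalarTower.algebraMap_eq P S L'] at this
    exact Function.Injective.of_comp this
  have algB : Algebra.IsAlgebraic P B := aux_algebraic
  have algA : Algebra.IsAlgebraic P A := by
    have : FaithfulSMul P B := (faithfulSMul_iff_algebraMap_injective P B).mpr hinjPB
    have : Algebra.IsAlgebraic B A := Algebra.IsIntegral.isAlgebraic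
    exact Algebra.IsAlgebraic.trans P B A
  have algL' : Algebra.IsAlgebraic P L' := by
    have : FaithfulSMul P A := (faithfulSMul_iff_algebraMap_injective P A).mpr hinjPA
    have : Algebra.IsAlgebraic A L' :=
      (IsFractionRing.comap_isAlgebraic_iff (A := A) (K := L)).mpr inferInstance
    exact Algebra.IsAlgebraic.trans P A L'
  have algS : Algebra.IsAlgebraic P S := algL'.tower_bot_of_injective hinjSL'
  have fe : Algebra.FormallyEtale P L' := aux_formallyEtale_field hinjPL'
  have : Module.Finite B R := .trans A R
  -- exponents
  let e : Fin n → ℕ := fun i => if i ∈ s then d else 1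
  have hze : ∀ i, z i ^ e i = algebraMap A R (x i) := by
    intro i
    by_cases hi : i ∈ s
    · simp only [e, if_pos hi, hz i hi]
    · simp only [e, if_neg hi, pow_one, hz' i hi]
  have he : ∀ i, 0 < e i := by
    intro i; by_cases hi : i ∈ s <;> simp [e, hi, hd]
  have hzL : ∀ i, algebraMap R L' (z i) ^ e i = algebraMap P L' (MvPolynomial.X i) := by
    intro i
    rw [← map_pow, hze, hx, ← IsScalarTower.algebraMap_apply A R L',
      ← IsScalarTower.algebraMap_apply P A L']
  have hCZ : CharZero L' := charZero_of_injective_algebraMap (algebraMap ℂ L').injective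
  have hz0 : ∀ i, algebraMap R L' (z i) ≠ 0 := by
    intro i h0
    have := hzL i
    rw [h0, zero_pow (he i).ne'] at this
    exact MvPolynomial.X_ne_zero i (hinjPL' (this.symm.trans (map_zero _).symm))
  -- derivations
  let c : Fin n → R := fun j => (e j : R) * z j ^ (e j - 1)
  have hDex : ∀ j, ∃ D : Derivation ℂ L' L', ∀ k, D (algebraMap P L' (MvPolynomial.X k)) =
      if j = k then algebraMap R L' (c j) else 0 :=
    fun j => aux_formallySmooth_deriv (n := n) (S := L') _
  choose D hD using hDex
  have hDz : ∀ j k, D j (algebraMap R L' (z k)) = if j = k then 1 else 0 := by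
    intro j k
    have h1 := hD j k
    rw [← hzL, Derivation.leibniz_pow] at h1
    have hc : (e k : L') * algebraMap R L' (z k) ^ (e k - 1) ≠ 0 :=
      mul_ne_zero (Nat.cast_ne_zero.mpr (he k).ne') (pow_ne_zero _ (hz0 k))
    apply mul_left_cancel₀ hc
    rw [nsmul_eq_mul, smul_eq_mul, ← mul_assoc] at h1
    rw [h1]
    by_cases hjk : j = k
    · subst hjk; simp [c]
    · simp [hjk]
  have hDB : ∀ j (b : B), ∃ r, D j (algebraMap R L' (algebraMap B R b)) = algebraMap R L' r := by
    intro j b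
    obtain ⟨E, hE⟩ := aux_formallySmooth_deriv (n := n) (S := B) (fun k => if j = k then 1 else 0)
    refine ⟨c j * algebraMap B R (E b), ?_⟩
    rw [← IsScalarTower.algebraMap_apply B R L', map_mul, ← IsScalarTower.algebraMap_apply B R L']
    refine aux_deriv_compare hinjPB hinjBL' (D j) E _ ?_ b
    intro k
    rw [hD, hE]
    split_ifs <;> simp
  have hDA : ∀ j (a : A), ∃ (N : ℕ) (r : R), algebraMap A L' ((∏ i ∈ s, x i) ^ N) *
      D j (algebraMap A L' a) = algebraMap R L' r := by
    intro j a
    obtain ⟨E, hE⟩ := aux_formallySmooth_deriv (n := n) (S := S) (fun k => if j = k then 1 else 0)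
    have h1 := aux_deriv_compare hinjPS hinjSL' (D j) E (algebraMap R L' (c j)) (by
      intro k
      rw [hD, hE]
      split_ifs <;> simp) (algebraMap A S a)
    obtain ⟨⟨a', ⟨_, N, rfl⟩⟩, ha⟩ :=
      IsLocalization.surj (Submonoid.powers (∏ i ∈ s, x i)) (E (algebraMap A S a))
    refine ⟨N, c j * algebraMap A R a', ?_⟩
    rw [← IsScalarTower.algebraMap_apply A S L'] at h1
    have h2 := congrArg (algebraMap S L') ha
    rw [map_mul, ← IsScalarTower.algebraMap_apply A S L',
      ← IsScalarTower.algebraMap_apply A S L'] at h2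
    change _ = algebraMap A L' a' at h2
    rw [h1, map_mul _ (c j) (algebraMap A R a'), ← IsScalarTower.algebraMap_apply A R L', ← h2]
    ring
  have hDR : ∀ j, ∃ E : Derivation ℂ R R, ∀ r, algebraMap R L' (E r) = D j (algebraMap R L' r) := by
    intro j
    refine aux_restrict_deriv hinjRL' (D j) ?_
    refine aux_star (B := B) (A := A) (L := L) hinj s x hx hx0 d hd hdd z hz hgen (D j) ?_
      (hDB j) (hDA j)
    intro k
    refine ⟨if j = k then 1 else 0, ?_⟩
    rw [hDz]; split_ifs <;> simp
  choose E hE using hDR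
  -- finite type
  have : Algebra.FiniteType ℂ A := by
    have h1 : Algebra.FiniteType P B := inferInstance
    have h2 : Algebra.FiniteType P A := .trans h1 (inferInstanceAs (Algebra.FiniteType B A))
    exact .trans (inferInstanceAs (Algebra.FiniteType ℂ P)) h2
  have : Algebra.FiniteType ℂ R := .trans this (inferInstanceAs (Algebra.FiniteType A R))
  let ψ : P →ₐ[ℂ] R := MvPolynomial.aeval z
  let : Algebra (MvPolynomial (Fin n) ℂ) R := ψ.toAlgebra
  have : IsScalarTower ℂ (MvPolynomial (Fin n) ℂ) R := .of_algebraMap_eq fun r => (ψ.commutes r).symm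
  have hψX : ∀ k, algebraMap P R (MvPolynomial.X k) = z k := fun k => MvPolynomial.aeval_X z k
  have : Algebra.IsAlgebraic (MvPolynomial (Fin n) ℂ) R := by
    constructor
    intro r
    obtain ⟨q, hq, hqr⟩ := Algebra.IsAlgebraic.isAlgebraic (R := P) (algebraMap R L' r)
    let φ : P →ₐ[ℂ] P := MvPolynomial.aeval fun i => MvPolynomial.X i ^ e i
    have hφ : (algebraMap R L').comp ((algebraMap P R).comp φ.toRingHom) = algebraMap P L' := by
      apply MvPolynomial.ringHom_ext
      · intro a
        have h1 : φ (MvPolynomial.C a) = MvPolynomial.C a := φ.commutes a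
        have h2 : algebraMap P R (MvPolynomial.C a) = algebraMap ℂ R a := ψ.commutes a
        have h3 : algebraMap P L' (MvPolynomial.C a) = algebraMap ℂ L' a :=
          (IsScalarTower.algebraMap_apply ℂ P L' a).symm
        change algebraMap R L' (algebraMap P R (φ (MvPolynomial.C a))) = _
        rw [h1, h2, h3, ← IsScalarTower.algebraMap_apply ℂ R L']
      · intro i
        have h1 : φ (MvPolynomial.X i) = MvPolynomial.X i ^ e i := MvPolynomial.aeval_X _ i
        change algebraMap R L' (algebraMap P R (φ (MvPolynomial.X i))) = _
        rw [h1, map_pow, map_pow, hψX, hzL]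
    have hφinj : Function.Injective φ.toRingHom := by
      have := hinjPL'
      rw [← hφ] at this
      exact Function.Injective.of_comp (f := fun y => algebraMap R L' (algebraMap P R y)) this
    refine ⟨q.map φ.toRingHom, (Polynomial.map_ne_zero_iff hφinj).mpr hq, hinjRL' ?_⟩
    rw [map_zero, ← hqr, Polynomial.aeval_def, Polynomial.eval₂_map, Polynomial.hom_eval₂, hφ,
      Polynomial.aeval_def]
  refine smooth_of_derivations (n := n) E ?_
  intro i j
  apply hinjRL'
  rw [hψX, hE, hDz]
  split_ifs <;> simp

theorem aux_clear {A L L' : Type} [CommRing A] [IsDomain A] [Field L] [Algebra A L] [IsFractionRing A L]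
    [Field L'] [Algebra L L'] [Algebra A L'] [IsScalarTower A L L'] (Z : Set L') (y : L')
    (hy : y ∈ Algebra.adjoin L Z) : ∃ a : A, a ≠ 0 ∧ algebraMap A L' a * y ∈ Algebra.adjoin A Z := by
  induction hy using Algebra.adjoin_induction with
  | mem y hy => exact ⟨1, one_ne_zero, by rw [map_one, one_mul]; exact Algebra.subset_adjoin hy⟩
  | algebraMap r =>
    obtain ⟨b, c, hc, rfl⟩ := IsFractionRing.div_surjective (A := A) r
    have hc0 : algebraMap A L c ≠ 0 := IsFractionRing.to_map_ne_zero_of_mem_nonZeroDivisors hc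
    refine ⟨c, nonZeroDivisors.ne_zero hc, ?_⟩
    rw [IsScalarTower.algebraMap_apply A L L', ← map_mul, mul_div_cancel₀ _ hc0,
      ← IsScalarTower.algebraMap_apply A L L']
    exact Subalgebra.algebraMap_mem _ _
  | add y y' _ _ h h' =>
    obtain ⟨a, ha, h⟩ := h
    obtain ⟨a', ha', h'⟩ := h'
    refine ⟨a * a', mul_ne_zero ha ha', ?_⟩
    have : algebraMap A L' (a * a') * (y + y') = algebraMap A L' a' * (algebraMap A L' a * y) +
      algebraMap A L' a * (algebraMap A L' a' * y') := by rw [map_mul]; ring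
    rw [this]
    exact add_mem (mul_mem (Subalgebra.algebraMap_mem _ _) h)
      (mul_mem (Subalgebra.algebraMap_mem _ _) h')
  | mul y y' _ _ h h' =>
    obtain ⟨a, ha, h⟩ := h
    obtain ⟨a', ha', h'⟩ := h'
    refine ⟨a * a', mul_ne_zero ha ha', ?_⟩
    have : algebraMap A L' (a * a') * (y * y') = (algebraMap A L' a * y) *
      (algebraMap A L' a' * y') := by rw [map_mul]; ring
    rw [this]
    exact mul_mem h h'

theorem aux_fixed {A L L' R : Type} [CommRing A] [IsDomain A] [IsIntegrallyClosed A] [Field L]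
    [Algebra A L] [IsFractionRing A L]
    [Field L'] [Algebra L L'] [Algebra A L'] [IsScalarTower A L L'] [FiniteDimensional L L']
    [IsGalois L L'] [CommRing R] [Algebra A R] [Algebra R L'] [IsScalarTower A R L']
    [IsIntegralClosure R A L'] [IsFractionRing R L'] [Algebra ℂ A] [Algebra ℂ R] [IsScalarTower ℂ A R]
    (hinj : Function.Injective (algebraMap A R)) :
    ∃ (G : Type) (_ : Group G) (_ : Finite G)
      (_ : MulSemiringAction G R) (_ : SMulCommClass G ℂ R),
      Nonempty (A ≃+* fixedSubalgebra G R) := by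
  let act := IsIntegralClosure.MulSemiringAction A L L' R
  have hinv : Algebra.IsInvariant A R (L' ≃ₐ[L] L') := Algebra.isInvariant_of_isGalois A L L' R
  have hA : ∀ (g : L' ≃ₐ[L] L') (a : A), g • algebraMap A R a = algebraMap A R a := by
    intro g a
    exact (galRestrict A L L' R g).commutes a
  have hcomm : SMulCommClass (L' ≃ₐ[L] L') ℂ R := ⟨fun g c r => by
    rw [Algebra.smul_def, smul_mul', IsScalarTower.algebraMap_apply ℂ A R, hA, Algebra.smul_def,
      IsScalarTower.algebraMap_apply ℂ A R]⟩
  refine ⟨L' ≃ₐ[L] L', inferInstance, inferInstance, act, hcomm, ⟨?_⟩⟩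
  let φ : A →+* fixedSubalgebra (L' ≃ₐ[L] L') R :=
    (algebraMap A R).codRestrict (fixedSubalgebra (L' ≃ₐ[L] L') R) (fun a g => hA g a)
  refine RingEquiv.ofBijective φ ⟨?_, ?_⟩
  · intro a b hab
    exact hinj (congrArg Subtype.val hab)
  · rintro ⟨r, hr⟩
    obtain ⟨a, ha⟩ := hinv.isInvariant r hr
    exact ⟨a, Subtype.ext ha⟩

theorem aux_main_alg {n : ℕ} {B A : Type} [CommRing B] [IsDomain B]
    [Algebra (MvPolynomial (Fin n) ℂ) B] 
    [Algebra.Etale (MvPolynomial (Fin n) ℂ) B]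
    [CommRing A] [IsDomain A] [IsIntegrallyClosed A] [Algebra B A]
    [Algebra (MvPolynomial (Fin n) ℂ) A] [IsScalarTower (MvPolynomial (Fin n) ℂ) B A]
    [Module.Finite B A] (hinj : Function.Injective (algebraMap B A))
    (s : Finset (Fin n)) (S : Type)
    [CommRing S] [Algebra A S] [Algebra (MvPolynomial (Fin n) ℂ) S]
    [IsScalarTower (MvPolynomial (Fin n) ℂ) A S]
    [Algebra.FormallySmooth (MvPolynomial (Fin n) ℂ) S]
    [IsLocalization.Away (algebraMap (MvPolynomial (Fin n) ℂ) A (∏ i ∈ s, MvPolynomial.X i)) S] :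
    ∃ (R : Type) (_ : CommRing R) (_ : Algebra ℂ R) (G : Type) (_ : Group G) (_ : Finite G)
      (_ : MulSemiringAction G R) (_ : SMulCommClass G ℂ R),
      Algebra.Smooth ℂ R ∧ Nonempty (A ≃+* fixedSubalgebra G R) := by
  classical
  let P := MvPolynomial (Fin n) ℂ
  let x : Fin n → A := fun i => algebraMap P A (MvPolynomial.X i)
  have hfx : algebraMap P A (∏ i ∈ s, MvPolynomial.X i) = ∏ i ∈ s, x i := map_prod _ _ _
  have hinjPB : Function.Injective (algebraMap P B) := aux_inj_of_flat
  have hinjPA : Function.Injective (algebraMap P A) := by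
    rw [IsScalarTower.algebraMap_eq P B A]; exact hinj.comp hinjPB
  have hx0 : ∀ i, x i ≠ 0 := fun i h0 =>
    MvPolynomial.X_ne_zero i (hinjPA (h0.trans (map_zero _).symm))
  have hf0 : (∏ i ∈ s, x i) ≠ 0 := Finset.prod_ne_zero_iff.mpr fun i _ => hx0 i
  have : IsNoetherianRing B := Algebra.FiniteType.isNoetherianRing P B
  have : IsNoetherianRing A := IsNoetherianRing.of_finite B A
  let : Algebra ℂ B := ((algebraMap P B).comp (algebraMap ℂ P)).toAlgebra
  have : IsScalarTower ℂ P B := .of_algebraMap_eq fun _ => rfl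
  let : Algebra ℂ A := ((algebraMap P A).comp (algebraMap ℂ P)).toAlgebra
  have : IsScalarTower ℂ P A := .of_algebraMap_eq fun _ => rfl
  let : Algebra ℂ S := ((algebraMap P S).comp (algebraMap ℂ P)).toAlgebra
  have : IsScalarTower ℂ P S := .of_algebraMap_eq fun _ => rfl
  have locS : IsLocalization.Away (∏ i ∈ s, x i) S := by rw [← hfx]; infer_instance
  have : IsDomain S := IsLocalization.isDomain_of_le_nonZeroDivisors
    (M := Submonoid.powers (∏ i ∈ s, x i)) (S := S)
    (powers_le_nonZeroDivisors_of_noZeroDivisors hf0)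
  obtain ⟨d, hd, hdd⟩ := aux_choose_d x hx0
  let L := FractionRing A
  obtain ⟨L', _, _, hfin, hgal, z, hz, hz', hgen⟩ := aux_field s (fun i => algebraMap A L (x i))
    (fun i => (map_ne_zero_iff _ (IsFractionRing.injective A L)).mpr (hx0 i)) d hd
  let : Algebra A L' := ((algebraMap L L').comp (algebraMap A L)).toAlgebra
  have : IsScalarTower A L L' := .of_algebraMap_eq fun _ => rfl
  have hinjAL' : Function.Injective (algebraMap A L') := by
    rw [IsScalarTower.algebraMap_eq A L L']
    exact (algebraMap L L').injective.comp (IsFractionRing.injective A L)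
  let : Algebra B L' := ((algebraMap A L').comp (algebraMap B A)).toAlgebra
  have : IsScalarTower B A L' := .of_algebraMap_eq fun _ => rfl
  let : Algebra P L' := ((algebraMap A L').comp (algebraMap P A)).toAlgebra
  have : IsScalarTower P A L' := .of_algebraMap_eq fun _ => rfl
  let : Algebra ℂ L' := ((algebraMap P L').comp (algebraMap ℂ P)).toAlgebra
  have : IsScalarTower ℂ P L' := .of_algebraMap_eq fun _ => rfl
  have : IsScalarTower ℂ A L' := .of_algebraMap_eq fun _ => rfl
  let : Algebra S L' := (IsLocalization.Away.lift (S := S) (∏ i ∈ s, x i) (g := algebraMap A L')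
    (IsUnit.mk0 _ ((map_ne_zero_iff _ hinjAL').mpr hf0))).toAlgebra
  have : IsScalarTower A S L' := .of_algebraMap_eq fun a =>
    (IsLocalization.Away.lift_eq (S := S) (∏ i ∈ s, x i) (g := algebraMap A L') _ a).symm
  let R := integralClosure A L'
  have : CharZero L := charZero_of_injective_algebraMap (algebraMap ℂ L).injective
  have : IsFractionRing R L' := integralClosure.isFractionRing_of_finite_extension L L'
  have : Module.Finite A R := IsIntegralClosure.finite A L L' R
  have : IsNoetherianRing R := IsNoetherianRing.of_finite A R
  have hinjAR : Function.Injective (algebraMap A R) := by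
    have := hinjAL'
    rw [IsScalarTower.algebraMap_eq A R L'] at this
    exact Function.Injective.of_comp (f := algebraMap R L') this
  have hzint : ∀ i, z i ∈ R := by
    intro i
    by_cases hi : i ∈ s
    · refine IsIntegral.of_pow hd ?_
      rw [hz i hi]
      exact isIntegral_algebraMap (R := A) (A := L') (x := x i)
    · rw [hz' i hi]
      exact isIntegral_algebraMap (R := A) (A := L') (x := x i)
  have hsm : Algebra.Smooth ℂ R := by
    refine aux_core (n := n) (B := B) (A := A) (S := S) (L := L) (L' := L') (R := R) hinj s x
      (fun _ => rfl) hx0 d hd hdd (fun i => ⟨z i, hzint i⟩) ?_ ?_ ?_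
    · intro i hi
      exact Subtype.ext (hz i hi)
    · intro i hi
      exact Subtype.ext (hz' i hi)
    · intro r
      obtain ⟨a, ha, h⟩ := aux_clear (A := A) (L := L) (Set.range fun i : s => z i) (r : L') (by
        rw [hgen]; trivial)
      refine ⟨a, ha, ?_⟩
      have h1 : (Algebra.adjoin A (Set.range fun i : s => (⟨z i, hzint i⟩ : R))).map
          (IsScalarTower.toAlgHom A R L') = Algebra.adjoin A (Set.range fun i : s => z i) := by
        rw [AlgHom.map_adjoin, ← Set.range_comp]
        rfl
      rw [← h1] at h
      obtain ⟨r', hr', h2⟩ := h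
      have : r' = algebraMap A R a * r := Subtype.ext h2
      rw [← this]
      exact hr'
  obtain ⟨G, i1, i2, i3, i4, h⟩ := aux_fixed (A := A) (L := L) (L' := L') (R := R) hinjAR
  exact ⟨R, inferInstance, inferInstance, G, i1, i2, i3, i4, hsm, h⟩

theorem aux_main_hom {n : ℕ} {B A T S : Type} [CommRing B] [IsDomain B] [CommRing A] [IsDomain A]
    [IsIntegrallyClosed A] [CommRing T] [CommRing S] [Algebra B T] [Algebra A S]
    (φ : MvPolynomial (Fin n) ℂ →+* B) (hφ : φ.Etale)
    (π : B →+* A) (hπ : π.Finite) (hinj : Function.Injective π)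
    (s : Finset (Fin n)) (f : B) (hf : f = φ (∏ i ∈ s, MvPolynomial.X i))
    (hT : IsLocalization.Away f T) (hS : IsLocalization.Away (π f) S)
    (σ : T →+* S) (hσ : σ.Smooth)
    (hcomm : ∀ b, σ (algebraMap B T b) = algebraMap A S (π b)) :
    ∃ (R : Type) (_ : CommRing R) (_ : Algebra ℂ R) (G : Type) (_ : Group G) (_ : Finite G)
      (_ : MulSemiringAction G R) (_ : SMulCommClass G ℂ R),
      Algebra.Smooth ℂ R ∧ Nonempty (A ≃+* fixedSubalgebra G R) := by
  let P := MvPolynomial (Fin n) ℂ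
  let : Algebra P B := φ.toAlgebra
  have : Algebra.Etale P B := hφ
  let : Algebra B A := π.toAlgebra
  have : Module.Finite B A := hπ
  let : Algebra P A := (π.comp φ).toAlgebra
  have : IsScalarTower P B A := .of_algebraMap_eq fun _ => rfl
  let : Algebra P S := ((algebraMap A S).comp (algebraMap P A)).toAlgebra
  have : IsScalarTower P A S := .of_algebraMap_eq fun _ => rfl
  let : Algebra P T := ((algebraMap B T).comp (algebraMap P B)).toAlgebra
  have : IsScalarTower P B T := .of_algebraMap_eq fun _ => rfl
  let : Algebra T S := σ.toAlgebra
  have : IsScalarTower P T S := .of_algebraMap_eq fun r => (hcomm (φ r)).symm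
  have : Algebra.Smooth T S := hσ
  have : Algebra.FormallySmooth B T := .of_isLocalization (Submonoid.powers f)
  have : Algebra.FormallySmooth P T := .comp P B T
  have : Algebra.FormallySmooth P S := .comp P T S
  have hS' : IsLocalization.Away (algebraMap P A (∏ i ∈ s, MvPolynomial.X i)) S := by
    change IsLocalization.Away (π (φ (∏ i ∈ s, MvPolynomial.X i))) S
    rw [← hf]; exact hS
  exact aux_main_alg (n := n) (B := B) (A := A) hinj s S

theorem aux_app_injective {X Y : Scheme.{0}} [IsIntegral Y] (p : X ⟶ Y) [IsDominant p]
    (W : Y.Opens) : Function.Injective (p.app W).hom := by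
  rw [injective_iff_map_eq_zero]
  intro f hf
  rw [← basicOpen_eq_bot_iff]
  by_contra hne
  have hne' : ((Y.basicOpen f : Y.Opens) : Set Y).Nonempty := by
    rw [Set.nonempty_iff_ne_empty]
    intro h
    exact hne (TopologicalSpace.Opens.ext h)
  obtain ⟨x, hx⟩ := (IsDominant.denseRange (f := p)).exists_mem_open (Y.basicOpen f).2 hne'
  have h1 : x ∈ p ⁻¹ᵁ Y.basicOpen f := hx
  rw [Scheme.preimage_basicOpen] at h1
  have h2 : (p.app W) f = 0 := hf
  rw [h2, Scheme.basicOpen_zero] at h1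
  exact h1

theorem aux_isIntegrallyClosed {X : Scheme.{0}} [IsIntegral X] (hX : IsNormalScheme X)
    (U : X.Opens) (hU : IsAffineOpen U) [Nonempty U] : IsIntegrallyClosed Γ(X, U) := by
  refine IsIntegrallyClosed.of_localization_maximal ?_
  intro p _ hp
  let q : PrimeSpectrum Γ(X, U) := ⟨p, hp.isPrime⟩
  have hq : hU.fromSpec q ∈ U := by
    have := hU.range_fromSpec
    rw [← SetLike.mem_coe, ← this]
    exact ⟨q, rfl⟩
  let : Algebra Γ(X, U) (X.presheaf.stalk (hU.fromSpec q)) :=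
    (X.presheaf.germ U _ hq).hom.toAlgebra
  have h1 : IsLocalization.AtPrime (X.presheaf.stalk (hU.fromSpec q)) p :=
    hU.isLocalization_stalk' q hq
  have h2 := hX (hU.fromSpec q)
  exact .of_equiv (IsLocalization.algEquiv p.primeCompl (X.presheaf.stalk (hU.fromSpec q))
    (Localization.AtPrime p)).toRingEquiv

theorem aux_smooth_app {X Y : Scheme.{0}} (p : X ⟶ Y) [IsAffineHom p] (V : Y.Opens)
    (hsm : Smooth (p ∣_ V)) (W : Y.Opens) (hW : IsAffineOpen W) (hWV : W ≤ V) :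
    (p.app W).hom.Smooth := by
  have key : ∀ (a : Y.Opens) (b : X.Opens) (_ : a = W) (_ : b = p ⁻¹ᵁ W) (e : b ≤ p ⁻¹ᵁ a),
      (p.appLE a b e).hom.Smooth → (p.app W).hom.Smooth := by
    intro a b ha hb e h
    subst ha
    subst hb
    rwa [Scheme.Hom.app_eq_appLE]
  have h1 : IsAffineOpen (V.ι ⁻¹ᵁ W) := hW.preimage_of_isOpenImmersion V.ι (by simpa using hWV)
  have hpW : p ⁻¹ᵁ W ≤ p ⁻¹ᵁ V := fun x hx => hWV hx
  have h2 : IsAffineOpen ((p ⁻¹ᵁ V).ι ⁻¹ᵁ (p ⁻¹ᵁ W)) :=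
    (hW.preimage p).preimage_of_isOpenImmersion (p ⁻¹ᵁ V).ι (by simpa using hpW)
  have e : (p ⁻¹ᵁ V).ι ⁻¹ᵁ (p ⁻¹ᵁ W) ≤ (p ∣_ V) ⁻¹ᵁ (V.ι ⁻¹ᵁ W) := by
    rw [← Scheme.Hom.comp_preimage, ← Scheme.Hom.comp_preimage, morphismRestrict_ι]
  have h3 := (p ∣_ V).smooth_appLE h1 h2 e
  rw [morphismRestrict_appLE] at h3
  refine key _ _ ?_ ?_ _ h3
  · rw [Scheme.Hom.image_preimage_eq_opensRange_inf, Scheme.Opens.opensRange_ι,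
      inf_eq_right.mpr hWV]
  · rw [Scheme.Hom.image_preimage_eq_opensRange_inf, Scheme.Opens.opensRange_ι,
      inf_eq_right.mpr hpW]

theorem aux_chart {Y : Scheme.{0}} (D : Set Y) (V : Y.Opens) (hV : (V : Set Y) = Dᶜ) (U : Y.Opens)
    (n : ℕ) (s : Finset (Fin n)) (g : U.toScheme ⟶ AffineSpaceC n) (hgE : Etale g)
    (hg : ∀ u : U.toScheme, g.base u ∈ coordinateHyperplanes n s ↔ (U.ι.base u : Y) ∈ D)
    (W : Y.Opens) (hW : IsAffineOpen W) (hWU : W ≤ U) :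
    ∃ φ : MvPolynomial (Fin n) ℂ →+* Γ(Y, W), φ.Etale ∧
      W ⊓ V = Y.basicOpen (φ (∏ i ∈ s, MvPolynomial.X i)) := by
  let j : Spec Γ(Y, W) ⟶ AffineSpaceC n := hW.isoSpec.inv ≫ Y.homOfLE hWU ≫ g
  have hj : Etale j := inferInstance
  let φ := Spec.preimage j
  have hφ : Spec.map φ = j := Spec.map_preimage j
  refine ⟨φ.hom, ?_, ?_⟩
  · rw [← HasRingHomProperty.Spec_iff (P := @Etale), hφ]
    exact hj
  · have hall : ∀ q : Spec Γ(Y, W), hW.fromSpec q ∈ V ↔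
        hW.fromSpec q ∈ Y.basicOpen (φ.hom (∏ i ∈ s, MvPolynomial.X i)) := by
      intro q
      let u : U.toScheme := (hW.isoSpec.inv ≫ Y.homOfLE hWU) q
      have hu : U.ι u = hW.fromSpec q := by
        change ((hW.isoSpec.inv ≫ Y.homOfLE hWU) ≫ U.ι) q = _
        rw [Category.assoc, Scheme.homOfLE_ι, hW.isoSpec_inv_ι]
      have hgu : g u = Spec.map φ q := by
        rw [hφ]
        rfl
      have h1 : hW.fromSpec q ∈ V ↔ ¬ (g u ∈ coordinateHyperplanes n s) := by
        have := hg u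
        change g u ∈ _ ↔ U.ι u ∈ D at this
        rw [this, hu, ← SetLike.mem_coe, hV]
        rfl
      have h2 : g u ∈ coordinateHyperplanes n s ↔
          (∏ i ∈ s, MvPolynomial.X i : MvPolynomial (Fin n) ℂ) ∈ (Spec.map φ q).asIdeal := by
        rw [hgu, coordinateHyperplanes, Scheme.mem_zeroLocus_iff]
        simp only [Set.mem_singleton_iff, forall_eq]
        have hb := basicOpen_eq_of_affine (R := CommRingCat.of (MvPolynomial (Fin n) ℂ))
          (∏ i ∈ s, MvPolynomial.X i)
        have hc : (Spec.map φ) q ∈ (AffineSpaceC n).basicOpen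
            ((Scheme.ΓSpecIso (CommRingCat.of (MvPolynomial (Fin n) ℂ))).inv
              (∏ i ∈ s, MvPolynomial.X i)) ↔
            ¬ ((∏ i ∈ s, MvPolynomial.X i : MvPolynomial (Fin n) ℂ) ∈
              (Spec.map φ q).asIdeal) := by
          rw [hb]
          rfl
        exact (not_congr hc).trans not_not
      have h3 : hW.fromSpec q ∈ Y.basicOpen (φ.hom (∏ i ∈ s, MvPolynomial.X i)) ↔
          ¬ (φ.hom (∏ i ∈ s, MvPolynomial.X i) ∈ q.asIdeal) := by
        have : q ∈ hW.fromSpec ⁻¹ᵁ Y.basicOpen (φ.hom (∏ i ∈ s, MvPolynomial.X i)) ↔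
          ¬ (φ.hom (∏ i ∈ s, MvPolynomial.X i) ∈ q.asIdeal) := by
          rw [hW.fromSpec_preimage_basicOpen]
          rfl
        exact this
      rw [h1, h2, h3]
      rfl
    have hran : ∀ w : Y, w ∈ W → ∃ q, hW.fromSpec q = w := by
      intro w hw
      have := hW.range_fromSpec
      rw [← SetLike.mem_coe, ← this] at hw
      exact hw
    ext w
    constructor
    · rintro ⟨hw, hwV⟩
      obtain ⟨q, rfl⟩ := hran w hw
      exact (hall q).mp hwV
    · intro hw
      have hwW : w ∈ W := Y.basicOpen_le _ hw
      obtain ⟨q, rfl⟩ := hran w hwW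
      exact ⟨hwW, (hall q).mpr hw⟩

theorem aux_final
    (X Y : Scheme.{0}) [IsIntegral X] (hXnormal : IsNormalScheme X) [IsIntegral Y]
    (p : X ⟶ Y) [IsFinite p] [IsDominant p]
    (D : Set Y) (hD : IsSNCDivisor D)
    (V : Y.Opens) (hV : (V : Set Y) = Dᶜ) (hsm : Smooth (p ∣_ V)) :
    HasFiniteQuotientSingularities X := by
  intro x
  obtain ⟨U, hyU, n, s, g, hgE, hg⟩ := hD.2 (p x)
  obtain ⟨W, hW, hyW, hWU⟩ := exists_isAffineOpen_mem_and_subset hyU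
  obtain ⟨φ, hφ, hWV⟩ := aux_chart D V hV U n s g hgE hg W hW hWU
  have hxW : x ∈ p ⁻¹ᵁ W := hyW
  have hpW : IsAffineOpen (p ⁻¹ᵁ W) := hW.preimage p
  have : Nonempty W := ⟨⟨_, hyW⟩⟩
  have : Nonempty (p ⁻¹ᵁ W : X.Opens) := ⟨⟨x, hxW⟩⟩
  have : IsIntegrallyClosed Γ(X, p ⁻¹ᵁ W) := aux_isIntegrallyClosed hXnormal _ hpW
  let f : Γ(Y, W) := φ (∏ i ∈ s, MvPolynomial.X i)
  have hbo : IsAffineOpen (Y.basicOpen f) := hW.basicOpen f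
  have hle : Y.basicOpen f ≤ V := by
    rw [← hWV]; exact inf_le_right
  let : Algebra Γ(Y, W) Γ(Y, Y.basicOpen f) :=
    (Y.presheaf.map (homOfLE (Y.basicOpen_le f)).op).hom.toAlgebra
  have hle' : p ⁻¹ᵁ Y.basicOpen f ≤ p ⁻¹ᵁ W := fun x hx => Y.basicOpen_le f hx
  let : Algebra Γ(X, p ⁻¹ᵁ W) Γ(X, p ⁻¹ᵁ Y.basicOpen f) :=
    (X.presheaf.map (homOfLE hle').op).hom.toAlgebra
  obtain ⟨R, _, _, G, _, _, _, _, hR, ⟨eqv⟩⟩ :=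
    aux_main_hom (n := n) (B := Γ(Y, W)) (A := Γ(X, p ⁻¹ᵁ W)) (T := Γ(Y, Y.basicOpen f))
      (S := Γ(X, p ⁻¹ᵁ Y.basicOpen f)) φ hφ (p.app W).hom (p.finite_app W hW)
      (aux_app_injective p W) s f rfl
      (hW.isLocalization_of_eq_basicOpen f (homOfLE (Y.basicOpen_le f)) rfl)
      (hpW.isLocalization_of_eq_basicOpen _ (homOfLE hle') (Scheme.preimage_basicOpen p f))
      (p.app (Y.basicOpen f)).hom (aux_smooth_app p V hsm _ hbo hle) (by
        intro b
        have := p.naturality (homOfLE (Y.basicOpen_le f)).op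
        exact congrArg (fun h => h.hom b) this)
  let i : Spec (CommRingCat.of (fixedSubalgebra G R)) ≅ Spec Γ(X, p ⁻¹ᵁ W) :=
    Scheme.Spec.mapIso (eqv.toCommRingCatIso).op
  refine ⟨{ R := R, smooth := hR, G := G, f := i.hom ≫ hpW.fromSpec, etale := ?_, mem := ?_ }⟩
  · have : Etale (i.hom ≫ hpW.fromSpec) := inferInstance
    exact this
  · have h1 : x ∈ Set.range hpW.fromSpec := by
      rw [hpW.range_fromSpec]; exact hxW
    obtain ⟨q, hq⟩ := h1
    refine ⟨i.inv q, ?_⟩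
    change (i.inv ≫ i.hom ≫ hpW.fromSpec) q = x
    rw [Iso.inv_hom_id_assoc, hq]

/-- Let `X` be a normal complex variety and let `p : X ⟶ Y` be a finite
dominant morphism to a smooth complex variety `Y`.  Suppose `D ⊆ Y` is a simple normal
crossing divisor and `p` is smooth over `Y \ D`.  Then `X` has finite quotient
singularities. -/
theorem hasFiniteQuotientSingularities_of_finite_dominant_smooth_over_snc_complement
    (X Y : Scheme) (sX : X ⟶ SpecC) (sY : Y ⟶ SpecC)
    -- `X` is a normal complex variety:
    [IsIntegral X] (hXsep : IsSeparated sX) (hXft : LocallyOfFiniteType sX)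
    (hXqc : QuasiCompact sX) (hXnormal : IsNormalScheme X)
    -- `Y` is a smooth complex variety:
    [IsIntegral Y] (hYsep : IsSeparated sY) (hYft : LocallyOfFiniteType sY)
    (hYqc : QuasiCompact sY) (hYsmooth : IsSmooth sY)
    -- `p : X ⟶ Y` is a finite dominant morphism over `ℂ`:
    (p : X ⟶ Y) (hp : p ≫ sY = sX) [IsFinite p] [IsDominant p]
    -- `D ⊆ Y` is a simple normal crossing divisor:
    (D : Set Y) (hD : IsSNCDivisor D)
    -- `p` is smooth over `Y \ D`:
    (V : Y.Opens) (hV : (V : Set Y) = Dᶜ) (hsm : IsSmooth (p ∣_ V)) :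
    HasFiniteQuotientSingularities X := by
  exact aux_final X Y hXnormal p D hD V hV hsm
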